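/- arXiv:2412.07308 — 3 statements merged into one kernel-verified Lean document; each statement's English description precedes it below -/
import Mathlib

section
/- Let a > 0 and b > 0 be real numbers, and let (a_n)_{n≥1} be a sequence of non-negative real numbers such that the Dirichlet series f(s) = Σ_{n=1}^∞ a_n n^{-s} converges for all complex s with Re(s) > a. Suppose there is an open set U of the complex plane containing the closed half-plane {s : Re(s) ≥ a} and a holomorphic function h on U with h(a) ≠ 0 such that f(s) = (s-a)^{-b} · h(s) for all s with Re(s) > a (with the principal branch of (s-a)^{-b}). Then there exists a constant c > 0 such that the partial sums g(X) = Σ_{n ≤ X} a_n satisfy g(X) ~ c · X^a · (log X)^{b-1} as X → ∞. -/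
namespace Dlg
open Filter MeasureTheory Topology Set

noncomputable def kk (t : ℝ) : ℝ := max 0 (1 - |t|)

lemma kk_cont : Continuous kk := by unfold kk; fun_prop
lemma kk_nonneg (t : ℝ) : 0 ≤ kk t := le_max_left _ _
lemma kk_le (t : ℝ) : kk t ≤ 1 := by
  unfold kk; exact max_le zero_le_one (by linarith [abs_nonneg t])
lemma kk_zero : kk 0 = 1 := by simp [kk]
lemma kk_supp {t : ℝ} (h : 1 ≤ |t|) : kk t = 0 := by
  unfold kk; exact max_eq_left (by linarith)
lemma kk_int : Integrable kk := by
  apply kk_cont.integrable_of_hasCompactSupport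
  apply HasCompactSupport.intro (isCompact_Icc (a := (-1:ℝ)) (b := 1))
  intro x hx
  apply kk_supp
  by_contra! h
  exact hx ⟨(abs_lt.mp h).1.le, (abs_lt.mp h).2.le⟩

noncomputable def KK (w : ℝ) : ℝ := ∫ t, kk t * Real.cos (t * w)

lemma KK_eq {w : ℝ} (hw : w ≠ 0) : KK w = 2 * (1 - Real.cos w) / w ^ 2 := by
  unfold KK
  have h1 : ∀ t : ℝ, kk t * Real.cos (t * w) = (fun s : ℝ => kk s * Real.cos (s * w)) |t| := by
    intro t
    have : kk |t| = kk t := by simp [kk]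
    simp only [this]
    rcases abs_choice t with h | h <;> rw [h]
    rw [neg_mul, Real.cos_neg]
  rw [integral_congr_ae (Eventually.of_forall h1)]
  rw [integral_comp_abs (f := fun s : ℝ => kk s * Real.cos (s * w))]
  have h2 : ∫ t in Ioi (0:ℝ), kk t * Real.cos (t * w) = ∫ t in Ioc (0:ℝ) 1, kk t * Real.cos (t * w) := by
    apply setIntegral_eq_of_subset_of_forall_sdiff_eq_zero measurableSet_Ioi
    · exact Ioc_subset_Ioi_self
    · intro x hx
      rw [kk_supp, zero_mul]
      have h1 : 0 < x := hx.1
      by_contra! h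
      exact hx.2 ⟨h1, (abs_lt.mp h).2.le⟩
  rw [h2, ← intervalIntegral.integral_of_le zero_le_one]
  have h3 : ∫ t in (0:ℝ)..1, kk t * Real.cos (t * w) = ∫ t in (0:ℝ)..1, (1 - t) * Real.cos (t * w) := by
    apply intervalIntegral.integral_congr
    intro t ht
    rw [uIcc_of_le zero_le_one] at ht
    simp only [kk]
    rw [abs_of_nonneg ht.1, max_eq_right (by linarith [ht.2])]
  rw [h3]
  have h4 : ∀ t ∈ uIcc (0:ℝ) 1, HasDerivAt (fun t => (1 - t) * Real.sin (t * w) / w - Real.cos (t * w) / w ^ 2)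
      ((1 - t) * Real.cos (t * w)) t := by
    intro t _
    have e1 : HasDerivAt (fun t : ℝ => t * w) w t := by simpa using (hasDerivAt_id t).mul_const w
    have e2 := e1.sin
    have e3 := e1.cos
    have e4 : HasDerivAt (fun t : ℝ => 1 - t) (-1) t := by simpa using (hasDerivAt_id t).const_sub 1
    have e5 := ((e4.mul e2).div_const w).sub (e3.div_const (w^2))
    have e6 : (-1 * Real.sin (t * w) + (1 - t) * (Real.cos (t * w) * w)) / w - -Real.sin (t * w) * w / w ^ 2
        = (1 - t) * Real.cos (t * w) := by
      field_simp
      ring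
    rw [← e6]
    exact e5
  rw [intervalIntegral.integral_eq_sub_of_hasDerivAt h4 (by
    apply Continuous.intervalIntegrable; fun_prop)]
  simp
  field_simp
  ring

lemma KK_nonneg (w : ℝ) : 0 ≤ KK w := by
  by_cases hw : w = 0
  · subst hw; unfold KK; apply integral_nonneg; intro t; simp [kk_nonneg]
  · rw [KK_eq hw]
    have := Real.cos_le_one w
    apply div_nonneg _ (sq_nonneg _); linarith

lemma kkcos_int (w : ℝ) : Integrable (fun t => kk t * Real.cos (t * w)) := by
  apply kk_int.mul_bdd (c := 1)
  · apply Continuous.aestronglyMeasurable; fun_prop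
  · filter_upwards with t; exact Real.abs_cos_le_one _

lemma KK_le (w : ℝ) : KK w ≤ ∫ t, kk t := by
  unfold KK
  apply integral_mono (kkcos_int w) kk_int
  intro t
  have := mul_le_mul_of_nonneg_left (Real.cos_le_one (t*w)) (kk_nonneg t)
  simpa using this

lemma KK_cont : Continuous KK := by
  unfold KK
  apply continuous_of_dominated (bound := kk)
  · intro w; exact (kkcos_int w).aestronglyMeasurable
  · intro w; filter_upwards with t
    rw [norm_mul, Real.norm_of_nonneg (kk_nonneg t)]
    exact mul_le_of_le_one_right (kk_nonneg t) (Real.abs_cos_le_one _)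
  · exact kk_int
  · filter_upwards with t; fun_prop

lemma KK_int : Integrable KK := by
  set B := ∫ t, kk t
  have : Integrable (fun x : ℝ => (B + 4) * (1 + x^2)⁻¹) := integrable_inv_one_add_sq.const_mul _
  apply this.mono' KK_cont.aestronglyMeasurable
  filter_upwards with w
  rw [Real.norm_of_nonneg (KK_nonneg w), ← div_eq_mul_inv, le_div_iff₀ (by positivity), mul_add, mul_one]
  apply add_le_add (KK_le w)
  by_cases hw : w = 0
  · subst hw; simp
  · rw [KK_eq hw, div_mul_cancel₀ _ (by positivity)]
    linarith [Real.neg_one_le_cos w]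

lemma KK_pos : 0 < ∫ w, KK w := by
  rw [integral_pos_iff_support_of_nonneg KK_nonneg KK_int]
  have h1 : (0:ENNReal) < volume (Ioo (0:ℝ) 1) := by simp
  apply h1.trans_le
  apply measure_mono
  intro w hw
  rw [Function.mem_support, KK_eq hw.1.ne']
  have h2 : Real.cos w < 1 := by
    have := Real.cos_lt_cos_of_nonneg_of_le_pi (x := 0) (y := w) le_rfl
      (by linarith [hw.2, Real.pi_gt_three]) hw.1
    simpa using this
  have h3 := hw.1
  have : 0 < 1 - Real.cos w := by linarith
  positivity

lemma KK_complex (w : ℝ) : (KK w : ℂ) = ∫ t, (kk t : ℂ) * Complex.exp (t * w * Complex.I) := by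
  have h0 : Integrable (fun t : ℝ => (kk t : ℂ) * Complex.exp (t * w * Complex.I)) := by
    apply kk_int.ofReal.mul_bdd (c := 1)
    · apply Continuous.aestronglyMeasurable; fun_prop
    · filter_upwards with t
      rw [← Complex.ofReal_mul, Complex.norm_exp_ofReal_mul_I]
  apply Complex.ext
  · rw [Complex.ofReal_re]
    have := integral_re (𝕜 := ℂ) h0
    simp only [RCLike.re_to_complex] at this
    rw [← this]; unfold KK
    congr 1; ext t
    rw [Complex.re_ofReal_mul, ← Complex.ofReal_mul, Complex.exp_ofReal_mul_I_re]
  · rw [Complex.ofReal_im]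
    have := integral_im (𝕜 := ℂ) h0
    simp only [RCLike.im_to_complex] at this
    rw [← this]
    symm
    have e : ∀ t : ℝ, ((kk t : ℂ) * Complex.exp (t * w * Complex.I)).im = kk t * Real.sin (t * w) := by
      intro t
      rw [Complex.im_ofReal_mul, ← Complex.ofReal_mul, Complex.exp_ofReal_mul_I_im]
    simp_rw [e]
    have h2 := integral_neg_eq_self (fun t : ℝ => kk t * Real.sin (t * w)) volume
    have h3 : ∀ t : ℝ, kk (-t) * Real.sin (-t * w) = - (kk t * Real.sin (t * w)) := by
      intro t
      have : kk (-t) = kk t := by simp [kk]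
      rw [this, neg_mul, Real.sin_neg, mul_neg]
    simp_rw [h3, integral_neg] at h2
    linarith


noncomputable def mu (β : ℝ) : Measure ℝ :=
  (volume.restrict (Ioi (0:ℝ))).withDensity (fun t => ENNReal.ofReal (t ^ (β - 1)))

lemma mu_integral (β : ℝ) (g : ℝ → ℂ) : ∫ t, g t ∂(mu β) = ∫ t in Ioi (0:ℝ), ((t ^ (β - 1) : ℝ) : ℂ) * g t := by
  unfold mu
  rw [integral_withDensity_eq_integral_toReal_smul (by fun_prop) (by simp)]
  apply setIntegral_congr_fun measurableSet_Ioi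
  intro t ht
  simp only
  rw [ENNReal.toReal_ofReal (Real.rpow_nonneg (le_of_lt ht) _)]
  simp

lemma mu_set (β : ℝ) (hβ : 0 < β) : Iio (0:ℝ) ⊆ ProbabilityTheory.integrableExpSet id (mu β) := by
  intro x hx
  show Integrable _ _
  unfold mu
  rw [integrable_withDensity_iff_integrable_smul' (by fun_prop) (by simp)]
  have hx' : 0 < -x := by simpa using hx
  have h := integrableOn_rpow_mul_exp_neg_mul_rpow (s := β - 1) (p := 1) (b := -x) (by linarith) one_pos hx'
  apply IntegrableOn.congr_fun h _ measurableSet_Ioi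
  intro t ht
  simp only
  rw [ENNReal.toReal_ofReal (Real.rpow_nonneg (le_of_lt ht) _)]
  simp

lemma mgf_eq {β : ℝ} (hβ : 0 < β) {z : ℂ} (hz : z.re < 0) :
    ProbabilityTheory.complexMGF id (mu β) z = Complex.Gamma β * (-z) ^ (-(β:ℂ)) := by
  have hsub : Iio (0:ℝ) ⊆ interior (ProbabilityTheory.integrableExpSet id (mu β)) :=
    interior_maximal (mu_set β hβ) isOpen_Iio
  have hopen : IsOpen {z : ℂ | z.re < 0} := isOpen_lt Complex.continuous_re continuous_const
  have h1 : AnalyticOnNhd ℂ (ProbabilityTheory.complexMGF id (mu β)) {z : ℂ | z.re < 0} :=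
    ProbabilityTheory.analyticOnNhd_complexMGF.mono (fun z hz => hsub hz)
  have h2 : AnalyticOnNhd ℂ (fun z : ℂ => Complex.Gamma β * (-z) ^ (-(β:ℂ))) {z : ℂ | z.re < 0} := by
    apply DifferentiableOn.analyticOnNhd _ hopen
    intro z hz
    apply DifferentiableAt.differentiableWithinAt
    apply DifferentiableAt.const_mul
    apply DifferentiableAt.cpow_const
    · fun_prop
    · left; simpa using hz
  have hpre : IsPreconnected {z : ℂ | z.re < 0} := (convex_halfSpace_re_lt 0).isPreconnected
  refine h1.eqOn_of_preconnected_of_frequently_eq h2 hpre (z₀ := (-1:ℂ)) (by simp) ?_ hz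
  have key : ∀ x : ℝ, x < 0 → ProbabilityTheory.complexMGF id (mu β) x = Complex.Gamma β * (-(x:ℂ)) ^ (-(β:ℂ)) := by
    intro x hx
    unfold ProbabilityTheory.complexMGF
    rw [mu_integral]
    have := Complex.integral_cpow_mul_exp_neg_mul_Ioi (a := β) (r := -x) (by simpa using hβ) (by linarith)
    rw [Complex.cpow_neg, mul_comm, ← Complex.inv_cpow, ← one_div]
    · rw [Complex.ofReal_neg] at this
      rw [← this]
      apply setIntegral_congr_fun measurableSet_Ioi
      intro t ht
      simp only
      rw [Complex.ofReal_cpow (le_of_lt ht)]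
      simp
    · rw [← Complex.ofReal_neg, Complex.arg_ofReal_of_nonneg (by linarith)]
      exact Real.pi_pos.ne
  have hf : ∃ᶠ x : ℝ in 𝓝[<] (-1:ℝ), x < 0 := by
    apply Eventually.frequently
    filter_upwards [self_mem_nhdsWithin] with x hx
    have : x < -1 := hx
    linarith
  have ht : Tendsto (fun x : ℝ => (x:ℂ)) (𝓝[<] (-1:ℝ)) (𝓝[≠] (-1:ℂ)) := by
    rw [tendsto_nhdsWithin_iff]
    constructor
    · have : Tendsto (fun x : ℝ => (x:ℂ)) (𝓝 (-1:ℝ)) (𝓝 ((-1:ℝ):ℂ)) := Complex.continuous_ofReal.tendsto _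
      simpa using this.mono_left nhdsWithin_le_nhds
    · filter_upwards [self_mem_nhdsWithin] with x hx
      have : x < -1 := hx
      intro h
      have h' : (x:ℂ) = -1 := h
      have : x = -1 := by exact_mod_cast h'
      linarith
  exact ht.frequently (hf.mono key)

lemma norm_cpow (β : ℝ) (y : ℝ) : ‖(1 + y * Complex.I) ^ (-(β:ℂ))‖ = (1 + ‖y‖ ^ 2) ^ (-β / 2) := by
  have h0 : (1 + y * Complex.I) ≠ 0 := by
    intro h; have := congrArg Complex.re h; simp at this
  rw [← Complex.ofReal_neg, Complex.norm_cpow_real, Complex.norm_eq_sqrt_sq_add_sq, Real.sqrt_eq_rpow,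
    ← Real.rpow_mul (by positivity)]
  simp
  ring_nf

lemma cpow_cont (β : ℝ) : Continuous (fun y : ℝ => (1 + y * Complex.I) ^ (-(β:ℂ))) := by
  rw [continuous_iff_continuousAt]
  intro y
  apply ContinuousAt.cpow _ continuousAt_const _
  · apply Continuous.continuousAt; fun_prop
  · left; simp

lemma cpow_int {β : ℝ} (hβ : 1 < β) : Integrable (fun y : ℝ => (1 + ‖y‖ ^ 2) ^ (-β / 2)) :=
  integrable_rpow_neg_one_add_norm_sq (by simpa using hβ)

lemma J_ne {β : ℝ} (hβ : 1 < β) :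
    ∫ y : ℝ, Complex.exp (y * Complex.I) * (1 + y * Complex.I) ^ (-(β:ℂ)) ≠ 0 := by
  set g : ℝ → ℂ := (Ioi (0:ℝ)).indicator (fun t => ((t ^ (β - 1) * Real.exp (-t) : ℝ) : ℂ)) with hg
  have hβ0 : 0 < β := by linarith
  have g_int : Integrable g := by
    rw [hg, integrable_indicator_iff measurableSet_Ioi]
    have := integrableOn_rpow_mul_exp_neg_mul_rpow (s := β - 1) (p := 1) (b := 1) (by linarith) one_pos one_pos
    simp at this
    exact this.ofReal
  have g_four : ∀ ξ : ℝ, FourierTransform.fourier g ξ = Complex.Gamma β * (1 + (2 * Real.pi * ξ : ℝ) * Complex.I) ^ (-(β:ℂ)) := by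
    intro ξ
    have := mgf_eq hβ0 (z := -(1 + (2 * Real.pi * ξ : ℝ) * Complex.I)) (by simp)
    rw [neg_neg] at this
    rw [← this]
    unfold ProbabilityTheory.complexMGF
    rw [mu_integral, Real.fourier_eq', ← integral_indicator measurableSet_Ioi]
    congr 1; ext t
    by_cases ht : t ∈ Ioi (0:ℝ)
    · simp only [hg, indicator_of_mem ht]
      push_cast
      simp only [smul_eq_mul]
      rw [mul_left_comm, ← Complex.exp_add]
      congr 2
      simp
      ring
    · simp [hg, indicator_of_notMem ht]
  have hc0 : Complex.Gamma β ≠ 0 := Complex.Gamma_ne_zero_of_re_pos (by simpa using hβ0)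
  have hint0 : Integrable (fun y : ℝ => (1 + y * Complex.I) ^ (-(β:ℂ))) := by
    apply (cpow_int hβ).mono' (cpow_cont β).aestronglyMeasurable
    filter_upwards with y
    rw [norm_cpow]
  have f_int : Integrable (FourierTransform.fourier g) := by
    have : FourierTransform.fourier g = fun ξ : ℝ => Complex.Gamma β * (1 + (2 * Real.pi * ξ : ℝ) * Complex.I) ^ (-(β:ℂ)) := funext g_four
    rw [this]
    exact (hint0.comp_mul_left' (R := 2 * Real.pi) (by positivity)).const_mul _
  have hcont : ContinuousAt g 1 := by
    have h1 : ContinuousAt (fun t : ℝ => ((t ^ (β - 1) * Real.exp (-t) : ℝ) : ℂ)) 1 := by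
      apply Complex.continuous_ofReal.continuousAt.comp
      apply ContinuousAt.mul
      · exact Real.continuousAt_rpow_const _ _ (Or.inl one_ne_zero)
      · fun_prop
    apply h1.congr
    filter_upwards [Ioi_mem_nhds (show (0:ℝ) < 1 by norm_num)] with t ht
    rw [hg, indicator_of_mem ht]
  have inv := g_int.fourierInv_fourier_eq f_int hcont
  rw [Real.fourierInv_eq'] at inv
  have hg1 : g 1 ≠ 0 := by
    rw [hg, indicator_of_mem (by simp)]
    simp
  intro hJ
  apply hg1
  rw [← inv]
  have e : ∀ ξ : ℝ, Complex.exp ((2 * Real.pi * inner ℝ ξ (1:ℝ) : ℝ) * Complex.I) • FourierTransform.fourier g ξ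
     = Complex.Gamma β * (fun y : ℝ => Complex.exp (y * Complex.I) * (1 + y * Complex.I) ^ (-(β:ℂ))) (2 * Real.pi * ξ) := by
    intro ξ
    rw [g_four]
    simp only [smul_eq_mul]
    simp
    ring_nf
  rw [integral_congr_ae (Eventually.of_forall e)]
  rw [integral_const_mul, Measure.integral_comp_mul_left
    (fun y : ℝ => Complex.exp (y * Complex.I) * (1 + y * Complex.I) ^ (-(β:ℂ))) (2 * Real.pi), hJ]
  simp

noncomputable def Fn (a β : ℝ) (H : ℂ → ℂ) (lam x y t : ℝ) : ℂ :=
  (kk (t / (lam * x)) : ℂ) * (Complex.exp (t * (y / x : ℝ) * Complex.I) / (a + (t / x : ℝ) * Complex.I)) *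
    ((1 + t * Complex.I) ^ (-(β:ℂ)) * H ((1 + t * Complex.I) / x))

lemma den_ne {a : ℝ} (ha : 0 < a) (s : ℝ) : (a + s * Complex.I : ℂ) ≠ 0 := by
  intro h; have := congrArg Complex.re h; simp at this; linarith

lemma den_norm {a : ℝ} (ha : 0 < a) (s : ℝ) : a ≤ ‖(a + s * Complex.I : ℂ)‖ := by
  have := Complex.abs_re_le_norm (a + s * Complex.I : ℂ)
  simp at this
  exact (le_abs_self a).trans this

lemma Fn_cont {a β : ℝ} (ha : 0 < a) {H : ℂ → ℂ} (hH : ContinuousOn H {z | 0 ≤ z.re}) {lam x : ℝ} (hx : 0 < x) (y : ℝ) :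
    Continuous (Fn a β H lam x y) := by
  unfold Fn
  have h1 : Continuous (fun t : ℝ => H ((1 + t * Complex.I) / x)) := by
    apply hH.comp_continuous (by fun_prop)
    intro t
    have : ((1 + t * Complex.I) / x : ℂ).re = 1 / x := by
      rw [Complex.div_ofReal_re]; simp
    rw [mem_ofPred_eq, this]; positivity
  have h2 := kk_cont
  have h3 := cpow_cont β
  have h4 : Continuous (fun t : ℝ => Complex.exp (t * (y / x : ℝ) * Complex.I) / (a + (t / x : ℝ) * Complex.I)) := by
    apply Continuous.div (by fun_prop) (by fun_prop)
    intro t; exact den_ne ha _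
  exact ((Complex.continuous_ofReal.comp (h2.comp (by fun_prop))).mul h4).mul (h3.mul h1)

lemma Fn_bound {a : ℝ} (β : ℝ) (ha : 0 < a) {H : ℂ → ℂ} (hH : ContinuousOn H {z | 0 ≤ z.re}) {lam : ℝ} (hl : 0 < lam) :
    ∃ M, 0 ≤ M ∧ ∀ x, 1 ≤ x → ∀ y t : ℝ, ‖Fn a β H lam x y t‖ ≤ M * (1 + ‖t‖ ^ 2) ^ (-β / 2) := by
  have hK : IsCompact (Icc (0:ℝ) 1 ×ℂ Icc (-lam) lam) := isCompact_Icc.reProdIm isCompact_Icc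
  obtain ⟨M, hM⟩ := hK.exists_bound_of_continuousOn (f := H) (hH.mono (by
    intro z hz; exact hz.1.1))
  have hM0 : 0 ≤ M := (norm_nonneg _).trans (hM 0 (by
    refine ⟨?_, ?_⟩ <;> simp [hl.le]))
  refine ⟨M / a, by positivity, ?_⟩
  intro x hx y t
  have hx0 : 0 < x := by linarith
  by_cases ht : 1 ≤ |t / (lam * x)|
  · unfold Fn
    rw [kk_supp ht]
    simp
    positivity
  · push Not at ht
    unfold Fn
    rw [norm_mul, norm_mul, norm_mul, norm_div, norm_cpow, ← Complex.ofReal_mul, Complex.norm_exp_ofReal_mul_I]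
    have hm : (1 + t * Complex.I) / x ∈ Icc (0:ℝ) 1 ×ℂ Icc (-lam) lam := by
      rw [abs_div, abs_of_pos (mul_pos hl hx0), div_lt_one (by positivity)] at ht
      have h3 : |t / x| ≤ lam := by
        rw [abs_div, abs_of_pos hx0, div_le_iff₀ hx0]; exact ht.le
      refine ⟨?_, ?_⟩
      · simp only [mem_preimage]
        rw [Complex.div_ofReal_re]; simp
        exact ⟨hx0.le, inv_le_one_of_one_le₀ hx⟩
      · simp only [mem_preimage]
        rw [Complex.div_ofReal_im]; simp
        exact abs_le.mp h3
    have h1 := hM _ hm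
    have h2 := den_norm ha (t / x)
    have h3 : ‖(kk (t / (lam * x)) : ℂ)‖ ≤ 1 := by
      rw [Complex.norm_real, Real.norm_of_nonneg (kk_nonneg _)]; exact kk_le _
    have h4 : 0 ≤ (1 + ‖t‖ ^ 2) ^ (-β / 2) := by positivity
    calc _ ≤ 1 * (1 / a) * ((1 + ‖t‖ ^ 2) ^ (-β / 2) * M) := by gcongr
      _ = _ := by ring

lemma T_bound {a β : ℝ} (ha : 0 < a) (hβ : 1 < β) {H : ℂ → ℂ} (hH : ContinuousOn H {z | 0 ≤ z.re}) {lam : ℝ} (hl : 0 < lam) :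
    ∃ M, 0 ≤ M ∧ ∀ x, 1 ≤ x → ∀ y : ℝ, ‖∫ t, Fn a β H lam x y t‖ ≤ M := by
  obtain ⟨M, hM0, hM⟩ := Fn_bound β ha hH hl
  refine ⟨∫ t : ℝ, M * (1 + ‖t‖ ^ 2) ^ (-β / 2), integral_nonneg (fun t => by positivity), ?_⟩
  intro x hx y
  exact norm_integral_le_of_norm_le ((cpow_int hβ).const_mul M) (Eventually.of_forall (hM x hx y))

lemma T_lim {a β : ℝ} (ha : 0 < a) (hβ : 1 < β) {H : ℂ → ℂ} (hH : ContinuousOn H {z | 0 ≤ z.re}) {lam : ℝ} (hl : 0 < lam)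
    (δ : ℝ) : Tendsto (fun x => ∫ t, Fn a β H lam x (x + δ) t) atTop
      (𝓝 ((H 0 / a) * ∫ t : ℝ, Complex.exp (t * Complex.I) * (1 + t * Complex.I) ^ (-(β:ℂ)))) := by
  obtain ⟨M, hM0, hM⟩ := Fn_bound β ha hH hl
  rw [← integral_const_mul]
  apply tendsto_integral_filter_of_dominated_convergence (fun t : ℝ => M * (1 + ‖t‖ ^ 2) ^ (-β / 2))
  · filter_upwards [eventually_gt_atTop 0] with x hx
    exact (Fn_cont ha hH hx _).aestronglyMeasurable
  · filter_upwards [eventually_ge_atTop 1] with x hx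
    exact Eventually.of_forall (hM x hx _)
  · exact (cpow_int hβ).const_mul M
  · refine Eventually.of_forall (fun t => ?_)
    unfold Fn
    have hdiv : ∀ c : ℝ, Tendsto (fun x : ℝ => c / x) atTop (𝓝 0) := fun c => tendsto_const_nhds.div_atTop tendsto_id
    have h1 : Tendsto (fun x : ℝ => kk (t / (lam * x))) atTop (𝓝 1) := by
      rw [← kk_zero]
      apply (kk_cont.tendsto 0).comp
      have := hdiv (t / lam)
      simpa [div_div] using this
    have h2 : Tendsto (fun x : ℝ => (x + δ) / x) atTop (𝓝 1) := by
      have : Tendsto (fun x : ℝ => 1 + δ / x) atTop (𝓝 (1 + 0)) := tendsto_const_nhds.add (hdiv δ)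
      rw [add_zero] at this
      apply this.congr'
      filter_upwards [eventually_gt_atTop 0] with x hx
      field_simp
    have h3 : Tendsto (fun x : ℝ => Complex.exp (t * ((x + δ) / x : ℝ) * Complex.I)) atTop (𝓝 (Complex.exp (t * (1:ℝ) * Complex.I))) := by
      have hc : Continuous (fun r : ℝ => Complex.exp (t * (r:ℝ) * Complex.I)) := by fun_prop
      exact (hc.tendsto 1).comp h2
    have h4 : Tendsto (fun x : ℝ => (a + (t / x : ℝ) * Complex.I : ℂ)) atTop (𝓝 (a + (0:ℝ) * Complex.I)) := by
      have hc : Continuous (fun r : ℝ => (a + (r : ℝ) * Complex.I : ℂ)) := by fun_prop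
      exact (hc.tendsto 0).comp (hdiv t)
    have h5 : Tendsto (fun x : ℝ => H ((1 + t * Complex.I) / x)) atTop (𝓝 (H 0)) := by
      have hc := hH 0 (by simp)
      apply hc.tendsto.comp
      rw [tendsto_nhdsWithin_iff]
      constructor
      · have : Tendsto (fun x : ℝ => (1 + t * Complex.I) * ((1 / x : ℝ) : ℂ)) atTop (𝓝 ((1 + t * Complex.I) * ((0:ℝ):ℂ))) :=
          tendsto_const_nhds.mul ((Complex.continuous_ofReal.tendsto 0).comp (hdiv 1))
        rw [Complex.ofReal_zero, mul_zero] at this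
        apply this.congr
        intro x
        push_cast
        ring
      · filter_upwards [eventually_gt_atTop 0] with x hx
        show 0 ≤ _
        rw [Complex.div_ofReal_re]; simp; exact hx.le
    have h6 := ((Complex.continuous_ofReal.tendsto 1).comp h1).mul (h3.div h4 (den_ne ha 0))
    have h7 := h6.mul (h5.const_mul ((1 + t * Complex.I) ^ (-(β:ℂ))))
    have e : (H 0 / a) * (Complex.exp (t * Complex.I) * (1 + t * Complex.I) ^ (-(β:ℂ))) =
        ((1:ℝ):ℂ) * (Complex.exp (t * (1:ℝ) * Complex.I) / (a + (0:ℝ) * Complex.I)) * ((1 + t * Complex.I) ^ (-(β:ℂ)) * H 0) := by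
      rw [Complex.ofReal_one, Complex.ofReal_zero, zero_mul, add_zero, mul_one]
      ring
    rw [e]
    exact h7

noncomputable def EE (a u : ℝ) : ℝ := if 0 ≤ u then Real.exp (-(a * u)) else 0

lemma EE_nonneg (a u : ℝ) : 0 ≤ EE a u := by unfold EE; split_ifs <;> positivity
lemma EE_le {a : ℝ} (ha : 0 < a) (u : ℝ) : EE a u ≤ 1 := by
  unfold EE; split_ifs with h
  · rw [Real.exp_le_one_iff]; nlinarith
  · exact zero_le_one
lemma EE_meas (a : ℝ) : Measurable (EE a) := by
  unfold EE
  exact Measurable.ite measurableSet_Ici (by fun_prop) measurable_const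

lemma EE_eq (a : ℝ) : EE a = (Ici (0:ℝ)).indicator (fun u => Real.exp (-(a * u))) := by
  ext u; simp [EE, indicator]

lemma EE_int {a : ℝ} (ha : 0 < a) : Integrable (EE a) := by
  rw [EE_eq, integrable_indicator_iff measurableSet_Ici, integrableOn_Ici_iff_integrableOn_Ioi]
  have := integrableOn_exp_mul_Ioi (a := -a) (by linarith) 0
  simpa using this

lemma den_ne' {a : ℝ} (ha : 0 < a) (s : ℂ) (hs : s.re = 0) : (a + s : ℂ) ≠ 0 := by
  intro h; have := congrArg Complex.re h; simp [hs] at this; linarith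

lemma EE_four {a : ℝ} (ha : 0 < a) (s : ℝ) :
    ∫ v, (EE a v : ℂ) * Complex.exp (-(s * v * Complex.I)) = 1 / (a + s * Complex.I) := by
  have h := integral_exp_mul_complex_Ioi (a := -(a + s * Complex.I)) (by simpa using ha) 0
  have e : (1 / (a + s * Complex.I) : ℂ) = -Complex.exp (-(a + s * Complex.I) * (0:ℝ)) / -(a + s * Complex.I) := by
    rw [Complex.ofReal_zero, mul_zero, Complex.exp_zero, neg_div_neg_eq]
  rw [e, ← h, ← integral_Ici_eq_integral_Ioi, ← integral_indicator measurableSet_Ici]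
  congr 1; ext v
  by_cases hv : v ∈ Ici (0:ℝ)
  · rw [indicator_of_mem hv, EE_eq, indicator_of_mem hv]
    push_cast
    rw [← Complex.exp_add]
    congr 1; ring
  · rw [indicator_of_notMem hv, EE_eq, indicator_of_notMem hv]; simp

lemma EE_shift_int {a : ℝ} (ha : 0 < a) {lam : ℝ} (hl : 0 < lam) (u : ℝ) : Integrable (fun w => EE a (u - w / lam)) := by
  have h1 : Integrable (fun w => EE a (u - w)) := (EE_int ha).comp_sub_left u
  have := h1.comp_mul_left' (R := lam⁻¹) (by positivity)
  simpa [div_eq_inv_mul] using this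

lemma smooth {a : ℝ} (ha : 0 < a) {lam : ℝ} (hl : 0 < lam) (u : ℝ) :
    ((∫ w, KK w * EE a (u - w / lam) : ℝ) : ℂ) =
      ∫ t, (kk t : ℂ) * (lam * Complex.exp (lam * t * u * Complex.I) / (a + lam * t * Complex.I)) := by
  rw [← integral_complex_ofReal]
  have h1 : ∀ w : ℝ, ((KK w * EE a (u - w / lam) : ℝ) : ℂ) =
      ∫ t, (kk t : ℂ) * Complex.exp (t * w * Complex.I) * (EE a (u - w / lam) : ℂ) := by
    intro w
    rw [integral_mul_const, ← KK_complex]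
    push_cast; rfl
  rw [integral_congr_ae (Eventually.of_forall h1), integral_integral_swap]
  · congr 1; ext t
    have h2 : ∀ w : ℝ, (kk t : ℂ) * Complex.exp (t * w * Complex.I) * (EE a (u - w / lam) : ℂ)
      = (fun v : ℝ => (kk t : ℂ) * Complex.exp (lam * t * u * Complex.I) * ((EE a (u - v) : ℂ) * Complex.exp (-((lam * t : ℝ) * (u - v : ℝ) * Complex.I)))) (lam⁻¹ * w) := by
      intro w
      simp only
      rw [← div_eq_inv_mul, mul_assoc (kk t : ℂ), mul_assoc (kk t : ℂ)]
      refine congrArg _ ?_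
      rw [mul_comm (EE a (u - w / lam) : ℂ), ← mul_assoc, ← Complex.exp_add]
      congr 2
      have : (lam : ℂ) ≠ 0 := by exact_mod_cast hl.ne'
      push_cast
      field_simp
      ring
    rw [integral_congr_ae (Eventually.of_forall h2), Measure.integral_comp_mul_left (fun v : ℝ => (kk t : ℂ) * Complex.exp (lam * t * u * Complex.I) * ((EE a (u - v) : ℂ) * Complex.exp (-((lam * t : ℝ) * (u - v : ℝ) * Complex.I)))),
      integral_const_mul, integral_sub_left_eq_self (fun v : ℝ => (EE a v : ℂ) * Complex.exp (-((lam * t : ℝ) * (v : ℝ) * Complex.I))), EE_four ha]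
    rw [inv_inv, abs_of_pos hl, Complex.real_smul]
    push_cast
    ring
  · have h3 : Integrable (fun p : ℝ × ℝ => (EE a (u - p.1 / lam) : ℂ) * (kk p.2 : ℂ)) (volume.prod volume) :=
      ((EE_shift_int ha hl u).ofReal (𝕜 := ℂ)).mul_prod (kk_int.ofReal (𝕜 := ℂ))
    have h4 := h3.mul_bdd (c := 1) (g := fun p : ℝ × ℝ => Complex.exp (p.2 * p.1 * Complex.I)) (by
      apply Continuous.aestronglyMeasurable; fun_prop) (by
      refine Eventually.of_forall (fun p => ?_)
      rw [← Complex.ofReal_mul, Complex.norm_exp_ofReal_mul_I])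
    apply h4.congr
    refine Eventually.of_forall (fun p => ?_)
    simp only [Function.uncurry]
    ring

noncomputable def AA (a : ℝ) (D l : ℕ → ℝ) (y : ℝ) : ℝ := ∑' n, D n * EE a (y - l n)

section
variable {a : ℝ} {D l : ℕ → ℝ}

lemma AA_summable (ha : 0 < a) (hD : ∀ n, 0 ≤ D n) (hs : Summable D) (y : ℝ) : Summable (fun n => D n * EE a (y - l n)) :=
  Summable.of_nonneg_of_le (fun n => mul_nonneg (hD n) (EE_nonneg _ _))
    (fun n => mul_le_of_le_one_right (hD n) (EE_le ha _)) hs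

lemma AA_nonneg (hD : ∀ n, 0 ≤ D n) (y : ℝ) : 0 ≤ AA a D l y :=
  tsum_nonneg (fun n => mul_nonneg (hD n) (EE_nonneg _ _))

lemma AA_le (ha : 0 < a) (hD : ∀ n, 0 ≤ D n) (hs : Summable D) (y : ℝ) : AA a D l y ≤ ∑' n, D n :=
  (AA_summable ha hD hs y).tsum_le_tsum (fun n => mul_le_of_le_one_right (hD n) (EE_le ha _)) hs

lemma EE_mono {u v : ℝ} (h : u ≤ v) : Real.exp (a * u) * EE a u ≤ Real.exp (a * v) * EE a v := by
  unfold EE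
  split_ifs with h1 h2 h2
  · rw [← Real.exp_add, ← Real.exp_add]; simp
  · exact absurd (h1.trans h) h2
  · rw [mul_zero]; positivity
  · simp

lemma AA_mono (ha : 0 < a) (hD : ∀ n, 0 ≤ D n) (hs : Summable D) : Monotone (fun y => Real.exp (a * y) * AA a D l y) := by
  intro u v h
  simp only [AA]
  rw [← tsum_mul_left, ← tsum_mul_left]
  apply ((AA_summable ha hD hs u).mul_left _).tsum_le_tsum _ ((AA_summable ha hD hs v).mul_left _)
  intro n
  have := EE_mono (a := a) (show u - l n ≤ v - l n by linarith)
  rw [mul_sub, mul_sub, Real.exp_sub, Real.exp_sub, div_mul_eq_mul_div, div_mul_eq_mul_div, div_le_div_iff_of_pos_right (by positivity)] at this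
  have := mul_le_mul_of_nonneg_left this (hD n)
  linarith

lemma AA_meas (ha : 0 < a) (hD : ∀ n, 0 ≤ D n) (hs : Summable D) : Measurable (AA a D l) := by
  have h1 := (AA_mono (l := l) ha hD hs).measurable
  have h2 : AA a D l = fun y => Real.exp (-(a * y)) * (Real.exp (a * y) * AA a D l y) := by
    ext y; rw [← mul_assoc, ← Real.exp_add]; simp
  rw [h2]
  exact Measurable.mul (by fun_prop) h1

lemma AA_int (ha : 0 < a) (hD : ∀ n, 0 ≤ D n) (hs : Summable D) (y lam : ℝ) :
    Integrable (fun w => KK w * AA a D l (y - w / lam)) := by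
  apply KK_int.mul_bdd (c := ∑' n, D n)
  · exact ((AA_meas ha hD hs).comp (by fun_prop)).aestronglyMeasurable
  · refine Eventually.of_forall (fun w => ?_)
    rw [Real.norm_of_nonneg (AA_nonneg hD _)]
    exact AA_le ha hD hs _

lemma smooth_sum (ha : 0 < a) (hD : ∀ n, 0 ≤ D n) (hs : Summable D) {lam : ℝ} (hl : 0 < lam) (y : ℝ) :
    ((∫ w, KK w * AA a D l (y - w / lam) : ℝ) : ℂ) =
      ∫ t, (kk t : ℂ) * (lam * Complex.exp (lam * t * y * Complex.I) / (a + lam * t * Complex.I)) *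
        ∑' n, (D n : ℂ) * Complex.exp (-(lam * t * l n * Complex.I)) := by
  have hki : ∀ u, Integrable (fun w => KK w * EE a (u - w / lam)) := by
    intro u
    apply KK_int.mul_bdd (c := 1)
    · exact ((EE_meas a).comp (by fun_prop)).aestronglyMeasurable
    · refine Eventually.of_forall (fun w => ?_)
      rw [Real.norm_of_nonneg (EE_nonneg _ _)]
      exact EE_le ha _
  have h1 : HasSum (fun n => ∫ w, D n * (KK w * EE a (y - l n - w / lam))) (∫ w, ∑' n, D n * (KK w * EE a (y - l n - w / lam))) := by
    apply hasSum_integral_of_summable_integral_norm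
    · intro n; exact (hki _).const_mul _
    · apply Summable.of_nonneg_of_le (fun n => integral_nonneg (fun w => norm_nonneg _)) _ (hs.mul_right (∫ w, KK w))
      intro n
      rw [← integral_const_mul]
      apply integral_mono ((hki _).const_mul _).norm (KK_int.const_mul _)
      intro w
      simp only
      rw [Real.norm_of_nonneg (mul_nonneg (hD n) (mul_nonneg (KK_nonneg _) (EE_nonneg _ _)))]
      exact mul_le_mul_of_nonneg_left (mul_le_of_le_one_right (KK_nonneg _) (EE_le ha _)) (hD n)
  have h2 : ∀ w, ∑' n, D n * (KK w * EE a (y - l n - w / lam)) = KK w * AA a D l (y - w / lam) := by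
    intro w
    unfold AA
    rw [← tsum_mul_left]
    congr 1; ext n
    rw [sub_right_comm]; ring
  simp_rw [h2, integral_const_mul] at h1
  set q : ℝ → ℂ := fun t => (kk t : ℂ) * (lam * Complex.exp (lam * t * y * Complex.I) / (a + lam * t * Complex.I)) with hq
  have q_int : Integrable q := by
    apply (kk_int.ofReal (𝕜 := ℂ)).mul_bdd (c := lam / a)
    · apply Continuous.aestronglyMeasurable
      apply Continuous.div (by fun_prop) (by fun_prop)
      intro t
      rw [mul_comm (lam:ℂ)]
      exact den_ne' ha _ (by simp)
    · refine Eventually.of_forall (fun t => ?_)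
      have e1 : ‖Complex.exp (lam * t * y * Complex.I)‖ = 1 := by
        rw [← Complex.ofReal_mul, ← Complex.ofReal_mul, Complex.norm_exp_ofReal_mul_I]
      rw [norm_div, norm_mul, e1, Complex.norm_real, Real.norm_of_nonneg hl.le, mul_one]
      apply div_le_div_of_nonneg_left hl.le ha
      have := Complex.abs_re_le_norm (a + lam * t * Complex.I : ℂ)
      simp at this
      exact (le_abs_self a).trans this
  have hb : ∀ n, ∀ t : ℝ, ‖Complex.exp (-(lam * t * l n * Complex.I))‖ = 1 := by
    intro n t
    rw [← neg_mul, ← Complex.ofReal_mul, ← Complex.ofReal_mul, ← Complex.ofReal_neg, Complex.norm_exp_ofReal_mul_I]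
  have hqi : ∀ n, Integrable (fun t : ℝ => (D n : ℂ) * (q t * Complex.exp (-(lam * t * l n * Complex.I)))) := by
    intro n
    apply Integrable.const_mul
    apply q_int.mul_bdd (c := 1)
    · apply Continuous.aestronglyMeasurable; fun_prop
    · exact Eventually.of_forall (fun t => (hb n t).le)
  have h3 : HasSum (fun n => ∫ t : ℝ, (D n : ℂ) * (q t * Complex.exp (-(lam * t * l n * Complex.I))))
      (∫ t : ℝ, ∑' n, (D n : ℂ) * (q t * Complex.exp (-(lam * t * l n * Complex.I)))) := by
    apply hasSum_integral_of_summable_integral_norm hqi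
    apply (hs.mul_right (∫ t, ‖q t‖)).congr
    intro n
    rw [← integral_const_mul]
    congr 1; ext t
    have e2 : ∀ A B : ℂ, ‖(D n : ℂ) * (A * B)‖ = D n * (‖A‖ * ‖B‖) := by
      intro A B
      rw [norm_mul, norm_mul, Complex.norm_real, Real.norm_of_nonneg (hD n)]
    rw [e2, hb, mul_one]
  have h4 : ∀ t : ℝ, ∑' n, (D n : ℂ) * (q t * Complex.exp (-(lam * t * l n * Complex.I))) = q t * ∑' n, (D n : ℂ) * Complex.exp (-(lam * t * l n * Complex.I)) := by
    intro t
    rw [← tsum_mul_left]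
    congr 1; ext n; ring
  simp_rw [h4] at h3
  have h5 := (Complex.hasSum_ofReal.mpr h1)
  refine h5.unique ?_
  convert h3 using 1
  ext n
  rw [integral_const_mul, Complex.ofReal_mul, smooth ha hl]
  congr 2
  ext t
  simp only [hq]
  rw [mul_assoc (kk t : ℂ), mul_div_right_comm, mul_div_right_comm,
    mul_assoc ((lam : ℂ) / (a + lam * t * Complex.I)) (Complex.exp _), ← Complex.exp_add]
  congr 3
  push_cast
  ring
end

lemma cpow_scale (β : ℝ) {x : ℝ} (hx : 0 < x) (t : ℝ) :
    ((1 + t * Complex.I) / x) ^ (-(β:ℂ)) = ((x ^ β : ℝ) : ℂ) * (1 + t * Complex.I) ^ (-(β:ℂ)) := by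
  have h0 : (1 + t * Complex.I) ≠ 0 := by
    intro h; have := congrArg Complex.re h; simp at this
  have e : (1 + t * Complex.I) / x = ((x⁻¹ : ℝ) : ℂ) * (1 + t * Complex.I) := by
    push_cast; ring
  have hx' : ((x⁻¹:ℝ):ℂ) ≠ 0 := by
    exact_mod_cast (inv_pos.mpr hx).ne'
  rw [e, Complex.cpow_def_of_ne_zero (mul_ne_zero hx' h0), Complex.log_ofReal_mul (by positivity) h0, add_mul, Complex.exp_add,
    ← Complex.cpow_def_of_ne_zero h0, Real.rpow_def_of_pos hx, Real.log_inv]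
  push_cast
  congr 2
  ring

section
variable {a β : ℝ} {d l : ℕ → ℝ} {H : ℂ → ℂ}

noncomputable def QQ (a : ℝ) (d l : ℕ → ℝ) (x y : ℝ) : ℝ := AA a (fun n => d n * Real.exp (-((a + 1 / x) * l n))) l y

lemma T_eq (ha : 0 < a) (hd : ∀ n, 0 ≤ d n)
    (hsum : ∀ ε : ℝ, 0 < ε → Summable (fun n => d n * Real.exp (-((a + ε) * l n))))
    (hF : ∀ z : ℂ, 0 < z.re → ∑' n, (d n : ℂ) * Complex.exp (-((a + z) * l n)) = z ^ (-(β:ℂ)) * H z)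
    {lam x : ℝ} (hl : 0 < lam) (hx : 0 < x) (y : ℝ) :
    ((∫ w, KK w * QQ a d l x (y - w / lam) : ℝ) : ℂ) = ((x ^ (β - 1) : ℝ) : ℂ) * ∫ t, Fn a β H lam x y t := by
  unfold QQ
  rw [smooth_sum ha (fun n => mul_nonneg (hd n) (Real.exp_pos _).le) (hsum _ (by positivity)) hl]
  set g : ℝ → ℂ := fun t => (kk t : ℂ) * (lam * Complex.exp (lam * t * y * Complex.I) / (a + lam * t * Complex.I)) *
        ∑' n, ((d n * Real.exp (-((a + 1 / x) * l n)) : ℝ) : ℂ) * Complex.exp (-(lam * t * l n * Complex.I)) with hg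
  have h1 := Measure.integral_comp_mul_left g (lam * x)⁻¹
  rw [inv_inv, abs_of_pos (mul_pos hl hx)] at h1
  have hlx : (lam * x : ℝ) ≠ 0 := (mul_pos hl hx).ne'
  have h2 : ∫ t, g t = (lam * x)⁻¹ • ∫ t, g ((lam * x)⁻¹ * t) := by
    rw [h1, smul_smul, inv_mul_cancel₀ hlx, one_smul]
  rw [h2, Complex.real_smul, ← integral_const_mul, ← integral_const_mul]
  congr 1; ext t
  have hlc : (lam : ℂ) ≠ 0 := by exact_mod_cast hl.ne'
  have hxc : (x : ℂ) ≠ 0 := by exact_mod_cast hx.ne'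
  have e1 : (lam : ℂ) * (((lam * x)⁻¹ * t : ℝ) : ℂ) = ((t / x : ℝ) : ℂ) := by
    push_cast; field_simp
  have e2 : ∑' n, ((d n * Real.exp (-((a + 1 / x) * l n)) : ℝ) : ℂ) * Complex.exp (-(((t / x : ℝ) : ℂ) * l n * Complex.I))
      = ((x ^ β : ℝ) : ℂ) * (1 + t * Complex.I) ^ (-(β:ℂ)) * H ((1 + t * Complex.I) / x) := by
    rw [← cpow_scale β hx, ← hF]
    · congr 1; ext n
      push_cast
      rw [mul_assoc, ← Complex.exp_add]
      congr 2
      field_simp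
      ring
    · rw [Complex.div_ofReal_re]; simp; exact hx
  simp only [hg]
  rw [e1, e2]
  unfold Fn
  have e3 : ((x ^ β : ℝ) : ℂ) = x * ((x ^ (β - 1) : ℝ) : ℂ) := by
    rw [← Complex.ofReal_mul]; congr 1
    rw [Real.rpow_sub_one hx.ne']; field_simp
  have e4 : (lam * x)⁻¹ * t = t / (lam * x) := by rw [div_eq_inv_mul]
  have e5 : ((t / x : ℝ) : ℂ) * y * Complex.I = t * (y / x : ℝ) * Complex.I := by
    push_cast; ring
  rw [e3, e4, e5]
  have e6 : (((lam * x)⁻¹ : ℝ) : ℂ) * lam * x = 1 := by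
    push_cast; field_simp
  linear_combination (kk (t / (lam * x)) : ℂ) * (Complex.exp (t * (y / x : ℝ) * Complex.I) / (a + (t / x : ℝ) * Complex.I)) *
    ((1 + t * Complex.I) ^ (-(β:ℂ)) * H ((1 + t * Complex.I) / x)) * ((x ^ (β - 1) : ℝ) : ℂ) * e6
end

noncomputable def ka (R : ℝ) : ℝ := ∫ w in Icc (-R) R, KK w

section
variable {a : ℝ} {Q : ℝ → ℝ}

lemma taub_upper (ha : 0 < a) (hQ0 : ∀ y, 0 ≤ Q y) (hQm : Monotone (fun y => Real.exp (a * y) * Q y))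
    {lam δ : ℝ} (hl : 0 < lam)
    (hi : ∀ y, Integrable (fun w => KK w * Q (y - w / lam))) (y : ℝ) :
    ka (δ * lam) * Q y ≤ Real.exp (2 * a * δ) * ∫ w, KK w * Q (y + δ - w / lam) := by
  have h1 : ∫ w in Icc (-(δ * lam)) (δ * lam), KK w * Q (y + δ - w / lam) ≤ ∫ w, KK w * Q (y + δ - w / lam) :=
    setIntegral_le_integral (hi _) (Eventually.of_forall (fun w => mul_nonneg (KK_nonneg _) (hQ0 _)))
  have h2 : ∫ w in Icc (-(δ * lam)) (δ * lam), KK w * (Real.exp (-(2 * a * δ)) * Q y) ≤ ∫ w in Icc (-(δ * lam)) (δ * lam), KK w * Q (y + δ - w / lam) := by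
    apply setIntegral_mono_on (KK_int.mul_const _).integrableOn (hi _).integrableOn measurableSet_Icc
    intro w hw
    apply mul_le_mul_of_nonneg_left _ (KK_nonneg _)
    have hw1 : w / lam ≤ δ := by rw [div_le_iff₀ hl]; exact hw.2
    have hw2 : -δ ≤ w / lam := by rw [le_div_iff₀ hl]; linarith [hw.1]
    have h3 := hQm (show y ≤ y + δ - w / lam by linarith)
    simp only at h3
    have h4 : Real.exp (a * (y + δ - w / lam)) * Q (y + δ - w / lam) ≤ Real.exp (a * y + 2 * a * δ) * Q (y + δ - w / lam) := by
      apply mul_le_mul_of_nonneg_right _ (hQ0 _)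
      rw [Real.exp_le_exp]
      nlinarith
    have h5 := h3.trans h4
    rw [Real.exp_add, mul_assoc] at h5
    have h6 := le_of_mul_le_mul_left h5 (Real.exp_pos _)
    rw [Real.exp_neg, inv_mul_le_iff₀ (Real.exp_pos _)]
    exact h6
  rw [integral_mul_const] at h2
  have h3 := h2.trans h1
  rw [← mul_le_mul_iff_right₀ (Real.exp_pos (2 * a * δ))] at h3
  refine le_trans (le_of_eq ?_) h3
  unfold ka
  rw [mul_left_comm, ← mul_assoc (Real.exp _), ← Real.exp_add]; simp

lemma taub_lower (ha : 0 < a) (hQ0 : ∀ y, 0 ≤ Q y) (hQm : Monotone (fun y => Real.exp (a * y) * Q y))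
    {lam δ B : ℝ} (hl : 0 < lam) (hB : ∀ y, Q y ≤ B)
    (hi : ∀ y, Integrable (fun w => KK w * Q (y - w / lam))) (y : ℝ) :
    ∫ w, KK w * Q (y - δ - w / lam) ≤ Real.exp (2 * a * δ) * (ka (δ * lam) * Q y) + ((∫ w, KK w) - ka (δ * lam)) * B := by
  have hms : MeasurableSet (Icc (-(δ * lam)) (δ * lam)) := measurableSet_Icc
  rw [← integral_add_compl hms (hi _)]
  have hK := integral_add_compl hms KK_int
  apply add_le_add
  · have h2 : ∫ w in Icc (-(δ * lam)) (δ * lam), KK w * Q (y - δ - w / lam) ≤ ∫ w in Icc (-(δ * lam)) (δ * lam), KK w * (Real.exp (2 * a * δ) * Q y) := by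
      apply setIntegral_mono_on (hi _).integrableOn (KK_int.mul_const _).integrableOn measurableSet_Icc
      intro w hw
      apply mul_le_mul_of_nonneg_left _ (KK_nonneg _)
      have hw1 : w / lam ≤ δ := by rw [div_le_iff₀ hl]; exact hw.2
      have hw2 : -δ ≤ w / lam := by rw [le_div_iff₀ hl]; linarith [hw.1]
      have h3 := hQm (show y - δ - w / lam ≤ y by linarith)
      simp only at h3
      have h4 : Real.exp (a * y - 2 * a * δ) * Q (y - δ - w / lam) ≤ Real.exp (a * (y - δ - w / lam)) * Q (y - δ - w / lam) := by
        apply mul_le_mul_of_nonneg_right _ (hQ0 _)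
        rw [Real.exp_le_exp]
        nlinarith
      have h5 := h4.trans h3
      rw [sub_eq_add_neg, Real.exp_add, mul_assoc] at h5
      have h6 := le_of_mul_le_mul_left h5 (Real.exp_pos _)
      rw [Real.exp_neg, inv_mul_le_iff₀ (Real.exp_pos _)] at h6
      exact h6
    refine h2.trans (le_of_eq ?_)
    rw [integral_mul_const]; unfold ka; ring
  · have h2 : ∫ w in (Icc (-(δ * lam)) (δ * lam))ᶜ, KK w * Q (y - δ - w / lam) ≤ ∫ w in (Icc (-(δ * lam)) (δ * lam))ᶜ, KK w * B := by
      apply setIntegral_mono_on (hi _).integrableOn (KK_int.mul_const _).integrableOn hms.compl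
      intro w hw
      exact mul_le_mul_of_nonneg_left (hB _) (KK_nonneg _)
    refine h2.trans (le_of_eq ?_)
    rw [integral_mul_const]; unfold ka
    congr 1; linarith
end

lemma ka_lim : Tendsto ka atTop (𝓝 (∫ w, KK w)) := by
  unfold ka
  exact (aecover_Icc tendsto_neg_atTop_atBot tendsto_id).integral_tendsto_of_countably_generated KK_int

lemma taub {a L M : ℝ} (ha : 0 < a) (Q : ℝ → ℝ → ℝ) (ω : ℝ → ℝ) (hω : ∀ x, 1 ≤ x → 0 < ω x)
    (hQ0 : ∀ x y, 1 ≤ x → 0 ≤ Q x y) (hQm : ∀ x, 1 ≤ x → Monotone (fun y => Real.exp (a * y) * Q x y))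
    (hi : ∀ x lam, 1 ≤ x → 0 < lam → ∀ y, Integrable (fun w => KK w * Q x (y - w / lam)))
    (hM : ∃ lam, 0 < lam ∧ 0 < ka lam ∧ ∀ x, 1 ≤ x → ∀ y, ∫ w, KK w * Q x (y - w / lam) ≤ M * ω x)
    (hL : ∀ lam, 0 < lam → ∀ δ, Tendsto (fun x => (∫ w, KK w * Q x (x + δ - w / lam)) / ω x) atTop (𝓝 L)) :
    Tendsto (fun x => Q x x / ω x) atTop (𝓝 (L / ∫ w, KK w)) := by
  obtain ⟨lam₀, hl₀, hk₀, hM⟩ := hM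
  set I := ∫ w, KK w with hI
  have hIpos : 0 < I := KK_pos
  obtain ⟨M', hM'⟩ : ∃ M', ∀ x, 1 ≤ x → ∀ y, Q x y ≤ M' * ω x := by
    refine ⟨Real.exp (2 * a * 1) * M / ka lam₀, ?_⟩
    intro x hx y
    have h1 := taub_upper (δ := 1) ha (hQ0 x · hx) (hQm x hx) hl₀ (hi x lam₀ hx hl₀) y
    rw [one_mul] at h1
    have h2 := h1.trans (mul_le_mul_of_nonneg_left (hM x hx (y + 1)) (Real.exp_pos _).le)
    rw [mul_comm, ← le_div_iff₀ hk₀] at h2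
    exact h2.trans (le_of_eq (by ring))
  have hexp : Tendsto (fun R : ℝ => Real.exp (2 * a * R⁻¹)) atTop (𝓝 1) := by
    have : Tendsto (fun R : ℝ => Real.exp (2 * a * R⁻¹)) atTop (𝓝 (Real.exp (2 * a * 0))) :=
      (Real.continuous_exp.tendsto _).comp (tendsto_inv_atTop_zero.const_mul _)
    simpa using this
  have hdl : ∀ R : ℝ, 0 < R → R⁻¹ * R ^ 2 = R := by intro R hR; field_simp
  rw [tendsto_order]
  constructor
  · intro u hu
    have h1 : Tendsto (fun R : ℝ => (L - (I - ka R) * M') / (Real.exp (2 * a * R⁻¹) * ka R)) atTop (𝓝 ((L - (I - I) * M') / (1 * I))) := by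
      apply Tendsto.div _ (hexp.mul ka_lim) (by positivity)
      exact tendsto_const_nhds.sub ((tendsto_const_nhds.sub ka_lim).mul_const _)
    rw [sub_self, zero_mul, sub_zero, one_mul] at h1
    obtain ⟨R, hR1, hR2, hR3⟩ := ((h1.eventually (lt_mem_nhds hu)).and ((eventually_gt_atTop (0:ℝ)).and (ka_lim.eventually (lt_mem_nhds hIpos)))).exists
    have h2 := ((hL (R ^ 2) (by positivity) (-R⁻¹)).sub_const ((I - ka R) * M')).div_const (Real.exp (2 * a * R⁻¹) * ka R)
    filter_upwards [h2.eventually (lt_mem_nhds hR1), eventually_ge_atTop 1] with x hx1 hx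
    apply hx1.trans_le
    have h3 := taub_lower (δ := R⁻¹) ha (hQ0 x · hx) (hQm x hx) (show 0 < R ^ 2 by positivity) (hM' x hx) (hi x _ hx (by positivity)) x
    rw [hdl R hR2] at h3
    have hw := hω x hx
    rw [div_le_div_iff₀ (by positivity) hw, sub_mul, div_mul_cancel₀ _ hw.ne', ← sub_eq_add_neg]
    rw [← hI] at h3
    linarith
  · intro u hu
    have h1 : Tendsto (fun R : ℝ => Real.exp (2 * a * R⁻¹) * L / ka R) atTop (𝓝 (1 * L / I)) :=
      (hexp.mul_const _).div ka_lim hIpos.ne'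
    rw [one_mul] at h1
    obtain ⟨R, hR1, hR2, hR3⟩ := ((h1.eventually (gt_mem_nhds hu)).and ((eventually_gt_atTop (0:ℝ)).and (ka_lim.eventually (lt_mem_nhds hIpos)))).exists
    have h2 := ((hL (R ^ 2) (by positivity) (R⁻¹)).const_mul (Real.exp (2 * a * R⁻¹))).div_const (ka R)
    filter_upwards [h2.eventually (gt_mem_nhds hR1), eventually_ge_atTop 1] with x hx1 hx
    apply lt_of_le_of_lt _ hx1
    have h3 := taub_upper (δ := R⁻¹) ha (hQ0 x · hx) (hQm x hx) (show 0 < R ^ 2 by positivity) (hi x _ hx (by positivity)) x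
    rw [hdl R hR2] at h3
    have hw := hω x hx
    rw [mul_div_assoc', div_div, div_le_div_iff₀ hw (by positivity)]
    have := mul_le_mul_of_nonneg_right h3 hw.le
    linarith

lemma core {a β : ℝ} {d l : ℕ → ℝ} {H : ℂ → ℂ} (ha : 0 < a) (hβ : 1 < β) (hd : ∀ n, 0 ≤ d n)
    (hsum : ∀ ε : ℝ, 0 < ε → Summable (fun n => d n * Real.exp (-((a + ε) * l n))))
    (hH : ContinuousOn H {z | 0 ≤ z.re}) (hH0 : H 0 ≠ 0)
    (hF : ∀ z : ℂ, 0 < z.re → ∑' n, (d n : ℂ) * Complex.exp (-((a + z) * l n)) = z ^ (-(β:ℂ)) * H z) :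
    ∃ c, 0 < c ∧ Tendsto (fun x => QQ a d l x x / x ^ (β - 1)) atTop (𝓝 c) := by
  set Lc : ℂ := (H 0 / a) * ∫ t : ℝ, Complex.exp (t * Complex.I) * (1 + t * Complex.I) ^ (-(β:ℂ)) with hLc
  have hLc0 : Lc ≠ 0 := mul_ne_zero (div_ne_zero hH0 (by exact_mod_cast ha.ne')) (J_ne hβ)
  have hpos : ∀ x : ℝ, 1 ≤ x → 0 < x ^ (β - 1) := fun x hx => by positivity
  have hD : ∀ x : ℝ, ∀ n, 0 ≤ d n * Real.exp (-((a + 1 / x) * l n)) := fun x n => mul_nonneg (hd n) (Real.exp_pos _).le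
  have hQ0 : ∀ x y, 0 ≤ QQ a d l x y := fun x y => AA_nonneg (hD x) y
  have hs : ∀ x : ℝ, 1 ≤ x → Summable (fun n => d n * Real.exp (-((a + 1 / x) * l n))) := fun x hx => hsum _ (by positivity)
  have hcl : ∀ lam, 0 < lam → ∀ δ, Tendsto (fun x => (((∫ w, KK w * QQ a d l x (x + δ - w / lam)) / x ^ (β - 1) : ℝ) : ℂ)) atTop (𝓝 Lc) := by
    intro lam hl δ
    apply (T_lim ha hβ hH hl δ).congr'
    filter_upwards [eventually_ge_atTop 1] with x hx
    rw [Complex.ofReal_div, T_eq ha hd hsum hF hl (by linarith), mul_div_cancel_left₀]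
    exact_mod_cast (hpos x hx).ne'
  have hLre : ∀ lam, 0 < lam → ∀ δ, Tendsto (fun x => ((∫ w, KK w * QQ a d l x (x + δ - w / lam)) / x ^ (β - 1))) atTop (𝓝 Lc.re) := by
    intro lam hl δ
    have := (Complex.continuous_re.tendsto _).comp (hcl lam hl δ)
    simpa only [Function.comp_def, Complex.ofReal_re] using this
  have him : Lc.im = 0 := by
    have := (Complex.continuous_im.tendsto _).comp (hcl 1 one_pos 0)
    simp only [Function.comp_def, Complex.ofReal_im] at this
    exact tendsto_nhds_unique this tendsto_const_nhds
  have hre0 : 0 ≤ Lc.re := by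
    apply ge_of_tendsto (hLre 1 one_pos 0)
    filter_upwards [eventually_ge_atTop 1] with x hx
    exact div_nonneg (integral_nonneg (fun w => mul_nonneg (KK_nonneg _) (hQ0 _ _))) (hpos x hx).le
  have hre : 0 < Lc.re := by
    apply lt_of_le_of_ne hre0
    intro h
    exact hLc0 (Complex.ext h.symm him)
  refine ⟨Lc.re / ∫ w, KK w, div_pos hre KK_pos, ?_⟩
  obtain ⟨lam, hk, hl⟩ := ((ka_lim.eventually (lt_mem_nhds KK_pos)).and (eventually_gt_atTop (0:ℝ))).exists
  obtain ⟨M, hM0, hM⟩ := T_bound ha hβ hH hl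
  apply taub (M := M) ha (QQ a d l) (fun x => x ^ (β - 1)) hpos (fun x y _ => hQ0 x y)
    (fun x hx => AA_mono ha (hD x) (hs x hx)) (fun x lam hx hl y => AA_int ha (hD x) (hs x hx) y lam) _ hLre
  refine ⟨lam, hl, hk, ?_⟩
  intro x hx y
  have h1 := T_eq ha hd hsum hF hl (show 0 < x by linarith) y
  have h2 := congrArg norm h1
  rw [norm_mul, Complex.norm_real, Complex.norm_real, Real.norm_of_nonneg (hpos x hx).le] at h2
  calc _ ≤ _ := le_abs_self _
    _ = _ := h2
    _ ≤ x ^ (β - 1) * M := mul_le_mul_of_nonneg_left (hM x hx y) (hpos x hx).le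
    _ = _ := mul_comm _ _

lemma deriv_step {a b : ℝ} {c l : ℕ → ℝ} (hc : ∀ n, 0 ≤ c n) (hl : ∀ n, 0 ≤ l n)
    (hsum : ∀ ε : ℝ, 0 < ε → Summable (fun n => c n * Real.exp (-((a + ε) * l n))))
    {U : Set ℂ} (hU : IsOpen U) (hUs : {s : ℂ | a ≤ s.re} ⊆ U) {h : ℂ → ℂ} (hh : DifferentiableOn ℂ h U)
    (hF : ∀ z : ℂ, 0 < z.re → ∑' n, (c n : ℂ) * Complex.exp (-((a + z) * l n)) = z ^ (-(b:ℂ)) * h (a + z))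
    {z : ℂ} (hz : 0 < z.re) :
    HasSum (fun n => ((c n * l n : ℝ) : ℂ) * Complex.exp (-((a + z) * l n)))
      (z ^ (-((b + 1 : ℝ):ℂ)) * (b * h (a + z) - z * deriv h (a + z))) := by
  have hV : IsOpen {w : ℂ | z.re / 2 < w.re} := isOpen_lt continuous_const Complex.continuous_re
  have hzV : z ∈ {w : ℂ | z.re / 2 < w.re} := by rw [mem_ofPred_eq]; linarith
  have hda : ∀ n, ∀ w : ℂ, HasDerivAt (fun w : ℂ => (c n : ℂ) * Complex.exp (-((a + w) * l n)))
      (-(((c n * l n : ℝ) : ℂ) * Complex.exp (-((a + w) * l n)))) w := by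
    intro n w
    have e1 : HasDerivAt (fun w : ℂ => -((a + w) * l n)) (-(1 * l n)) w :=
      (((hasDerivAt_id w).const_add (a:ℂ)).mul_const (l n : ℂ)).neg
    have e2 := (e1.cexp).const_mul (c n : ℂ)
    have e3 : -(((c n * l n : ℝ) : ℂ) * Complex.exp (-((a + w) * l n))) =
        (c n : ℂ) * (Complex.exp (-((a + w) * l n)) * -(1 * l n)) := by push_cast; ring
    rw [e3]; exact e2
  have h1 := Complex.hasSum_deriv_of_summable_norm (F := fun n (w : ℂ) => (c n : ℂ) * Complex.exp (-((a + w) * l n)))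
    (hsum (z.re / 2) (by positivity)) (fun n => fun w _ => (hda n w).differentiableAt.differentiableWithinAt) hV
    (by
      intro n w hw
      rw [mem_ofPred_eq] at hw
      rw [norm_mul, Complex.norm_real, Real.norm_of_nonneg (hc n), Complex.norm_exp]
      apply mul_le_mul_of_nonneg_left _ (hc n)
      rw [Real.exp_le_exp]
      simp
      have := mul_le_mul_of_nonneg_right hw.le (hl n)
      linarith) hzV
  simp_rw [fun n => (hda n z).deriv] at h1
  have h2 : deriv (fun w : ℂ => ∑' n, (c n : ℂ) * Complex.exp (-((a + w) * l n))) z =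
      deriv (fun w : ℂ => w ^ (-(b:ℂ)) * h (a + w)) z := by
    apply Filter.EventuallyEq.deriv_eq
    filter_upwards [hV.mem_nhds hzV] with w hw
    have hw : z.re / 2 < w.re := hw
    exact hF w (by linarith)
  have hmem : (a + z) ∈ U := hUs (by rw [mem_ofPred_eq]; simp; linarith)
  have h3 : HasDerivAt (fun w : ℂ => h (a + w)) (deriv h (a + z)) z := by
    have := ((hh.differentiableAt (hU.mem_nhds hmem)).hasDerivAt).comp_const_add (a:ℂ) z
    exact this
  have h4 : HasDerivAt (fun w : ℂ => w ^ (-(b:ℂ))) (-(b:ℂ) * z ^ (-(b:ℂ) - 1) * 1) z :=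
    (hasDerivAt_id z).cpow_const (Or.inl hz)
  have h5 := (h4.mul h3).deriv
  have h6 : deriv (fun w : ℂ => w ^ (-(b:ℂ)) * h (a + w)) z = -(b:ℂ) * z ^ (-(b:ℂ) - 1) * 1 * h (a + z) + z ^ (-(b:ℂ)) * deriv h (a + z) := h5
  rw [h2, h6] at h1
  have hz0 : z ≠ 0 := by intro h; rw [h] at hz; simp at hz
  have h7 := h1.neg
  simp only [neg_neg] at h7
  have e1 : z ^ (-(b:ℂ)) = z ^ (-(b:ℂ) - 1) * z := by
    rw [Complex.cpow_sub _ _ hz0, Complex.cpow_one]; field_simp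
  have e2 : -((b + 1 : ℝ):ℂ) = -(b:ℂ) - 1 := by push_cast; ring
  have e3 : z ^ (-((b+1:ℝ):ℂ)) * (b * h (a+z) - z * deriv h (a+z)) =
      -(-(b:ℂ) * z ^ (-(b:ℂ) - 1) * 1 * h (a + z) + z ^ (-(b:ℂ)) * deriv h (a + z)) := by
    rw [e1, e2]; ring
  rw [e3]; exact h7

noncomputable def NN (c l : ℕ → ℝ) (x : ℝ) : ℝ := ∑' n, if l n ≤ x then c n else 0

section
variable {a : ℝ} {c l : ℕ → ℝ}

lemma N_term {σ : ℝ} (hσ : 0 ≤ σ) (hc : ∀ n, 0 ≤ c n) (x : ℝ) (n : ℕ) :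
    (if l n ≤ x then c n else 0) ≤ Real.exp (σ * x) * (c n * Real.exp (-(σ * l n))) := by
  split_ifs with h
  · rw [mul_left_comm, ← Real.exp_add]
    apply le_mul_of_one_le_right (hc n)
    rw [Real.one_le_exp_iff]
    nlinarith
  · have := hc n; positivity

lemma N_summable (ha : 0 < a) (hc : ∀ n, 0 ≤ c n)
    (hsum : ∀ ε : ℝ, 0 < ε → Summable (fun n => c n * Real.exp (-((a + ε) * l n)))) (x : ℝ) :
    Summable (fun n => if l n ≤ x then c n else 0) := by
  refine Summable.of_nonneg_of_le (fun n => ?_) (N_term (show 0 ≤ a + 1 by linarith) hc x) ((hsum 1 one_pos).mul_left _)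
  split_ifs
  · exact hc n
  · exact le_rfl

lemma N_bound (ha : 0 < a) (hc : ∀ n, 0 ≤ c n)
    (hsum : ∀ ε : ℝ, 0 < ε → Summable (fun n => c n * Real.exp (-((a + ε) * l n)))) {ε : ℝ} (hε : 0 < ε) (x : ℝ) :
    NN c l x ≤ Real.exp ((a + ε) * x) * ∑' n, c n * Real.exp (-((a + ε) * l n)) := by
  unfold NN
  rw [← tsum_mul_left]
  exact (N_summable ha hc hsum x).tsum_le_tsum (N_term (by linarith) hc x) ((hsum ε hε).mul_left _)

lemma Q_eq (x : ℝ) : Real.exp (a * x) * QQ a (fun n => c n * l n) l x x =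
    ∑' n, if l n ≤ x then c n * (l n * Real.exp (-(l n / x))) else 0 := by
  unfold QQ AA
  rw [← tsum_mul_left]
  congr 1; ext n
  unfold EE
  simp only [sub_nonneg]
  split_ifs with h
  · have : Real.exp (a * x) * Real.exp (-((a + 1 / x) * l n)) * Real.exp (-(a * (x - l n))) = Real.exp (-(l n / x)) := by
      rw [← Real.exp_add, ← Real.exp_add]; congr 1; ring
    rw [← this]; ring
  · simp

lemma N_lower (ha : 0 < a) (hc : ∀ n, 0 ≤ c n) (hl : ∀ n, 0 ≤ l n)
    (hsum : ∀ ε : ℝ, 0 < ε → Summable (fun n => c n * Real.exp (-((a + ε) * l n)))) {x : ℝ} (hx : 0 < x) :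
    (Summable fun n => if l n ≤ x then c n * (l n * Real.exp (-(l n / x))) else 0) ∧
    Real.exp (a * x) * QQ a (fun n => c n * l n) l x x ≤ x * Real.exp (-1) * NN c l x := by
  have hle : ∀ n, (if l n ≤ x then c n * (l n * Real.exp (-(l n / x))) else 0) ≤ x * Real.exp (-1) * (if l n ≤ x then c n else 0) := by
    intro n
    split_ifs with h
    · rw [mul_comm]
      apply mul_le_mul_of_nonneg_right _ (hc n)
      have h1 := Real.add_one_le_exp (l n / x - 1)
      rw [sub_add_cancel, div_le_iff₀ hx] at h1
      calc _ ≤ Real.exp (l n / x - 1) * x * Real.exp (-(l n / x)) := mul_le_mul_of_nonneg_right h1 (Real.exp_pos _).le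
        _ = x * Real.exp (-1) := by
          rw [mul_right_comm, ← Real.exp_add, mul_comm]; congr 2; ring
    · simp
  have hs := (N_summable ha hc hsum x).mul_left (x * Real.exp (-1))
  have hs2 : (Summable fun n => if l n ≤ x then c n * (l n * Real.exp (-(l n / x))) else 0) := by
    refine Summable.of_nonneg_of_le (fun n => ?_) hle hs
    split_ifs
    · exact mul_nonneg (hc n) (mul_nonneg (hl n) (Real.exp_pos _).le)
    · exact le_rfl
  refine ⟨hs2, ?_⟩
  rw [Q_eq]
  unfold NN
  rw [← tsum_mul_left]
  exact hs2.tsum_le_tsum hle hs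

lemma N_upper (ha : 0 < a) (hc : ∀ n, 0 ≤ c n) (hl : ∀ n, 0 ≤ l n)
    (hsum : ∀ ε : ℝ, 0 < ε → Summable (fun n => c n * Real.exp (-((a + ε) * l n)))) {x θ : ℝ} (hx : 0 < x)
    (hθ : 0 < θ) (hθ1 : θ < 1) :
    θ * Real.exp (-1) * x * NN c l x ≤ Real.exp (a * x) * QQ a (fun n => c n * l n) l x x + θ * Real.exp (-1) * x * NN c l (θ * x) := by
  rw [Q_eq]
  unfold NN
  rw [← tsum_mul_left, ← tsum_mul_left, ← (N_lower ha hc hl hsum hx).1.tsum_add ((N_summable ha hc hsum _).mul_left _)]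
  apply ((N_summable ha hc hsum _).mul_left _).tsum_le_tsum _ ((N_lower ha hc hl hsum hx).1.add ((N_summable ha hc hsum _).mul_left _))
  intro n
  have hcn := hc n
  have hln := hl n
  by_cases h1 : l n ≤ θ * x
  · have h2 : l n ≤ x := h1.trans (by nlinarith)
    simp only [h1, h2, if_true]
    have : 0 ≤ c n * (l n * Real.exp (-(l n / x))) := by positivity
    linarith
  · by_cases h2 : l n ≤ x
    · simp only [h1, h2, if_true, if_false, mul_zero, add_zero]
      rw [mul_comm]
      apply mul_le_mul_of_nonneg_left _ hcn
      rw [mul_right_comm]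
      apply mul_le_mul (by linarith) _ (Real.exp_pos _).le hln
      rw [Real.exp_le_exp, neg_le_neg_iff, div_le_one hx]
      exact h2
    · simp [h1, h2]

lemma N_lim {b c₁ : ℝ} (ha : 0 < a) (hc : ∀ n, 0 ≤ c n) (hl : ∀ n, 0 ≤ l n) (hc₁ : 0 < c₁)
    (hsum : ∀ ε : ℝ, 0 < ε → Summable (fun n => c n * Real.exp (-((a + ε) * l n))))
    (hq : Tendsto (fun x => QQ a (fun n => c n * l n) l x x / x ^ b) atTop (𝓝 c₁)) :
    Tendsto (fun x => NN c l x / (Real.exp (a * x) * x ^ (b - 1))) atTop (𝓝 (Real.exp 1 * c₁)) := by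
  rw [tendsto_order]
  constructor
  · intro u hu
    filter_upwards [(hq.const_mul (Real.exp 1)).eventually (lt_mem_nhds hu), eventually_gt_atTop 0] with x h1 hx
    apply h1.trans_le
    have h2 := (N_lower ha hc hl hsum hx).2
    rw [mul_div_assoc', div_le_div_iff₀ (by positivity) (by positivity), Real.rpow_sub_one hx.ne']
    have h3 := mul_le_mul_of_nonneg_left h2 (show 0 ≤ Real.exp 1 * (x ^ b / x) by positivity)
    refine le_trans (le_of_eq (by ring)) (h3.trans (le_of_eq ?_))
    rw [Real.exp_neg]
    field_simp
  · intro u hu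
    have h1 : Tendsto (fun θ : ℝ => Real.exp 1 * c₁ / θ) (𝓝[<] 1) (𝓝 (Real.exp 1 * c₁ / 1)) := by
      apply Tendsto.mono_left _ nhdsWithin_le_nhds
      exact tendsto_const_nhds.div tendsto_id one_ne_zero
    rw [div_one] at h1
    have h01 : ∀ᶠ θ : ℝ in 𝓝[<] 1, 0 < θ ∧ θ < 1 := by
      filter_upwards [self_mem_nhdsWithin, nhdsWithin_le_nhds (lt_mem_nhds (show (0:ℝ) < 1 by norm_num))] with θ h1 h2
      exact ⟨h2, h1⟩
    obtain ⟨θ, hθu, hθ, hθ1⟩ := ((h1.eventually (gt_mem_nhds hu)).and h01).exists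
    set ε := a * (1 - θ) with hε
    have hε0 : 0 < ε := mul_pos ha (by linarith)
    set C := ∑' n, c n * Real.exp (-((a + ε) * l n)) with hC
    set η := a - (a + ε) * θ with hη
    have hη0 : 0 < η := by
      have : η = a * (1 - θ) ^ 2 := by rw [hη, hε]; ring
      rw [this]; have : 0 < 1 - θ := by linarith
      positivity
    have h2 : Tendsto (fun x : ℝ => Real.exp 1 / θ * (QQ a (fun n => c n * l n) l x x / x ^ b) + C * (x ^ (1 - b) * Real.exp (-η * x)))
        atTop (𝓝 (Real.exp 1 / θ * c₁ + C * 0)) :=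
      (hq.const_mul _).add ((tendsto_rpow_mul_exp_neg_mul_atTop_nhds_zero _ _ hη0).const_mul _)
    have h3 : Real.exp 1 / θ * c₁ + C * 0 < u := by
      refine lt_of_eq_of_lt ?_ hθu; ring
    filter_upwards [h2.eventually (gt_mem_nhds h3), eventually_gt_atTop 0] with x h4 hx
    apply lt_of_le_of_lt _ h4
    have h5 := N_upper ha hc hl hsum hx hθ hθ1
    have h6 := N_bound ha hc hsum hε0 (θ * x)
    have h7 := h5.trans (add_le_add_right (mul_le_mul_of_nonneg_left h6 (show 0 ≤ θ * Real.exp (-1) * x by positivity)) _)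
    rw [div_le_iff₀ (by positivity)]
    have hk : 0 < θ * Real.exp (-1) * x := by positivity
    rw [← mul_le_mul_iff_right₀ hk]
    refine h7.trans (le_of_eq ?_)
    rw [← hC]
    have e1 : Real.exp ((a + ε) * (θ * x)) = Real.exp (-η * x) * Real.exp (a * x) := by
      rw [← Real.exp_add]; congr 1; rw [hη]; ring
    have e2 : x ^ (1 - b) * x ^ (b - 1) = 1 := by
      rw [← Real.rpow_add hx]; simp
    have e3 : x ^ (b - 1) = x ^ b / x := Real.rpow_sub_one hx.ne' b
    have e4 : Real.exp (-1) * Real.exp 1 = 1 := by rw [← Real.exp_add]; simp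
    have e5 : Real.exp 1 / θ * (QQ a (fun n => c n * l n) l x x / x ^ b) * (Real.exp (a * x) * x ^ (b - 1)) * (θ * Real.exp (-1) * x)
       = Real.exp (a * x) * QQ a (fun n => c n * l n) l x x := by
      rw [e3]
      have : x ^ b ≠ 0 := by positivity
      have e6 : Real.exp (-1) = (Real.exp 1)⁻¹ := Real.exp_neg 1
      rw [e6]
      field_simp
    rw [e1]
    linear_combination (-1 : ℝ) * e5 - θ * Real.exp (-1) * x * C * Real.exp (-η * x) * Real.exp (a * x) * e2
end

lemma NN_eq (coeff : ℕ → ℝ) {X : ℝ} (hX : 0 < X) :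
    NN (fun n => coeff (n + 1)) (fun n => Real.log ((n + 1 : ℕ) : ℝ)) (Real.log X) = ∑ n ∈ Finset.Icc 1 ⌊X⌋₊, coeff n := by
  unfold NN
  have hiff : ∀ n : ℕ, Real.log ((n + 1 : ℕ) : ℝ) ≤ Real.log X ↔ n ∈ Finset.range ⌊X⌋₊ := by
    intro n
    rw [Real.log_le_log_iff (by positivity) hX, Finset.mem_range, ← Nat.succ_le_iff, Nat.le_floor_iff hX.le]
  simp_rw [hiff]
  rw [tsum_eq_sum (s := Finset.range ⌊X⌋₊) (fun n hn => by simp only [hn, if_false])]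
  rw [Finset.sum_congr rfl (fun n hn => if_pos hn), Finset.range_eq_Ico, Finset.sum_Ico_add' coeff 0 ⌊X⌋₊ 1]
  rfl

end Dlg

open Filter Finset

/-- **Delange's tauberian theorem.** If the Dirichlet series `f(s) = ∑ aₙ n^{-s}` with
non-negative coefficients converges for `Re s > a`, and `f(s) = (s-a)^{-b} h(s)` on this
half-plane with `h` holomorphic on an open neighbourhood `U` of `{Re s ≥ a}` and `h(a) ≠ 0`,
then `∑_{n ≤ X} aₙ ~ c Xᵃ (log X)^{b-1}` for some constant `c > 0`. -/
theorem delange_tauberian (a b : ℝ) (ha : 0 < a) (hb : 0 < b) (coeff : ℕ → ℝ)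
    (hnonneg : ∀ n, 1 ≤ n → 0 ≤ coeff n)
    (hconv : ∀ s : ℂ, a < s.re →
      Summable (fun n : ℕ => (coeff (n + 1) : ℂ) * ((n + 1 : ℕ) : ℂ) ^ (-s)))
    (U : Set ℂ) (hUopen : IsOpen U) (hUsub : {s : ℂ | a ≤ s.re} ⊆ U)
    (h : ℂ → ℂ) (hh : DifferentiableOn ℂ h U) (hha : h (a : ℂ) ≠ 0)
    (heq : ∀ s : ℂ, a < s.re →
      (∑' n : ℕ, (coeff (n + 1) : ℂ) * ((n + 1 : ℕ) : ℂ) ^ (-s))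
        = (s - (a : ℂ)) ^ (-(b : ℂ)) * h s) :
    ∃ c : ℝ, 0 < c ∧
      Tendsto (fun X : ℝ =>
          (∑ n ∈ Finset.Icc 1 ⌊X⌋₊, coeff n) / (c * X ^ a * (Real.log X) ^ (b - 1)))
        atTop (nhds 1) := by
  set c : ℕ → ℝ := fun n => coeff (n + 1) with hcdef
  set l : ℕ → ℝ := fun n => Real.log ((n + 1 : ℕ) : ℝ) with hldef
  have hc : ∀ n, 0 ≤ c n := fun n => hnonneg _ (by omega)
  have hl : ∀ n, 0 ≤ l n := fun n => Real.log_nonneg (by push_cast; linarith [(Nat.cast_nonneg n : (0:ℝ) ≤ n)])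
  have hpow : ∀ (n : ℕ) (s : ℂ), ((n + 1 : ℕ) : ℂ) ^ (-s) = Complex.exp (-(s * l n)) := by
    intro n s
    rw [Complex.cpow_def_of_ne_zero (by exact_mod_cast Nat.succ_ne_zero n), Complex.natCast_log.symm]
    congr 1
    ring
  simp_rw [hpow] at hconv heq
  have hsum : ∀ ε : ℝ, 0 < ε → Summable (fun n => c n * Real.exp (-((a + ε) * l n))) := by
    intro ε hε
    have := hconv ((a + ε : ℝ) : ℂ) (by simpa using hε)
    rw [← Complex.summable_ofReal]
    apply this.congr
    intro n
    push_cast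
    rfl
  have hF : ∀ z : ℂ, 0 < z.re → ∑' n, (c n : ℂ) * Complex.exp (-((a + z) * l n)) = z ^ (-(b:ℂ)) * h (a + z) := by
    intro z hz
    have := heq (a + z) (by simpa using hz)
    rw [add_sub_cancel_left] at this
    exact this
  have hstep := fun (z : ℂ) (hz : 0 < z.re) => Dlg.deriv_step hc hl hsum hUopen hUsub hh hF hz
  have hmap : ∀ z ∈ {z : ℂ | 0 ≤ z.re}, (a + z : ℂ) ∈ U := by
    intro z hz
    apply hUsub
    rw [Set.mem_ofPred_eq] at hz ⊢
    simpa using hz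
  obtain ⟨c₁, hc₁, hq⟩ := Dlg.core (a := a) (β := b + 1) (d := fun n => c n * l n) (l := l)
    (H := fun z => b * h (a + z) - z * deriv h (a + z)) ha (by linarith) (fun n => mul_nonneg (hc n) (hl n))
    (by
      intro ε hε
      have := (hstep (ε : ℂ) (by simpa using hε)).summable
      rw [← Complex.summable_ofReal]
      apply this.congr
      intro n
      push_cast
      rfl)
    (by
      have h1 : ContinuousOn (fun z : ℂ => (a + z : ℂ)) {z : ℂ | 0 ≤ z.re} := by fun_prop
      have h2 := hh.continuousOn.comp h1 hmap
      have h3 := (hh.deriv hUopen).continuousOn.comp h1 hmap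
      exact (continuousOn_const.mul h2).sub (continuousOn_id.mul h3))
    (by
      simp only [add_zero, zero_mul, sub_zero]
      exact mul_ne_zero (by exact_mod_cast hb.ne') hha)
    (fun z hz => (hstep z hz).tsum_eq)
  rw [add_sub_cancel_right] at hq
  have hN := Dlg.N_lim ha hc hl hc₁ hsum hq
  refine ⟨Real.exp 1 * c₁, by positivity, ?_⟩
  have hpos : 0 < Real.exp 1 * c₁ := by positivity
  have h1 := (hN.comp Real.tendsto_log_atTop).div_const (Real.exp 1 * c₁)
  rw [div_self hpos.ne'] at h1
  apply h1.congr'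
  filter_upwards [eventually_gt_atTop 0] with X hX
  simp only [Function.comp_apply]
  rw [Dlg.NN_eq coeff hX, Real.rpow_def_of_pos hX a, mul_comm (Real.log X) a, div_div]
  congr 1
  ring
end

section
/- Let p be a prime number, let ℤ_p denote the ring of p-adic integers, and let Λ = ℤ_p⟦T⟧ be the ring of formal power series in one variable over ℤ_p. Let N be a finitely generated torsion Λ-module. Then N is finitely generated as a ℤ_p-module (via restriction of scalars along the inclusion ℤ_p → Λ) if and only if the quotient N/pN is finite. -/
/-- Finite free `ℤ_p`-modules are `p`-adically precomplete. -/
theorem precomplete_pi_Zp (p : ℕ) [Fact p.Prime] (ι : Type*) :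
    IsPrecomplete (Ideal.span {(p : ℤ_[p])}) (ι → ℤ_[p]) := by
  have key : ∀ (n : ℕ) (x y : ι → ℤ_[p]),
      x ≡ y [SMOD ((Ideal.span {(p : ℤ_[p])}) ^ n • ⊤ : Submodule ℤ_[p] (ι → ℤ_[p]))] ↔
      ∀ i, x i ≡ y i [SMOD ((Ideal.span {(p : ℤ_[p])}) ^ n • ⊤ : Submodule ℤ_[p] ℤ_[p])] := by
    intro n x y
    simp only [SModEq.sub_mem, Ideal.span_singleton_pow, Submodule.ideal_span_singleton_smul,
      Submodule.mem_smul_pointwise_iff_exists, Submodule.mem_top, true_and]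
    constructor
    · rintro ⟨b, hb⟩ i
      exact ⟨b i, congrFun hb i⟩
    · intro h
      choose b hb using h
      exact ⟨b, funext hb⟩
  have h1 : IsPrecomplete (Ideal.span {(p : ℤ_[p])}) ℤ_[p] := by
    rw [← PadicInt.maximalIdeal_eq_span_p]
    infer_instance
  refine ⟨fun f hf => ?_⟩
  have h2 : ∀ i, ∃ L : ℤ_[p], ∀ n, f n i ≡ L
      [SMOD ((Ideal.span {(p : ℤ_[p])}) ^ n • ⊤ : Submodule ℤ_[p] ℤ_[p])] := fun i =>
    h1.prec' (fun n => f n i) (fun {m n} hmn => (key m _ _).1 (hf hmn) i)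
  choose L hL using h2
  exact ⟨L, fun n => (key n _ _).2 fun i => hL i n⟩

/-- Let `Λ = ℤ_p⟦T⟧` be the Iwasawa algebra and `N` a finitely generated torsion
`Λ`-module. Then `N` is finitely generated as a `ℤ_p`-module if and only if
`N/pN` is finite. -/
theorem finite_over_Zp_iff_quotient_p_finite (p : ℕ) [Fact p.Prime]
    (N : Type*) [AddCommGroup N]
    [Module (PowerSeries ℤ_[p]) N] [Module ℤ_[p] N]
    [IsScalarTower ℤ_[p] (PowerSeries ℤ_[p]) N]
    [Module.Finite (PowerSeries ℤ_[p]) N]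
    (htors : Module.IsTorsion (PowerSeries ℤ_[p]) N) :
    Module.Finite ℤ_[p] N ↔
      Finite (N ⧸ ((Ideal.span {(p : ℤ_[p])}) • (⊤ : Submodule ℤ_[p] N))) := by
  set I : Ideal ℤ_[p] := Ideal.span {(p : ℤ_[p])} with hI
  constructor
  · intro hfin
    have : Finite (ℤ_[p] ⧸ I) := by
      rw [hI, ← PadicInt.maximalIdeal_eq_span_p]
      exact Finite.of_equiv _ (PadicInt.residueField (p := p)).symm.toEquiv
    have : Module.Finite (ℤ_[p] ⧸ I) (N ⧸ (I • (⊤ : Submodule ℤ_[p] N))) :=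
      Module.Finite.of_restrictScalars_finite ℤ_[p] _ _
    exact Module.finite_of_finite (ℤ_[p] ⧸ I)
  · intro hfin
    have hH : IsHausdorff I N := by
      rw [← IsHausdorff.map_algebraMap_iff (S := PowerSeries ℤ_[p])]
      apply IsHausdorff.of_le_jacobson
      rw [hI, Ideal.map_span, Set.image_singleton, Ideal.span_singleton_le_iff_mem,
        Ideal.mem_jacobson_bot]
      intro y
      rw [PowerSeries.isUnit_iff_constantCoeff]
      have hp : (p : ℤ_[p]) ∈ Ideal.jacobson (⊥ : Ideal ℤ_[p]) := by
        apply IsLocalRing.maximalIdeal_le_jacobson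
        rw [PadicInt.maximalIdeal_eq_span_p]
        exact Ideal.mem_span_singleton_self _
      simpa using Ideal.mem_jacobson_bot.1 hp (PowerSeries.constantCoeff y)
    let Q := N ⧸ (I • (⊤ : Submodule ℤ_[p] N))
    have : Fintype Q := Fintype.ofFinite Q
    have := precomplete_pi_Zp p Q
    let f : (Q → ℤ_[p]) →ₗ[ℤ_[p]] N :=
      Fintype.linearCombination ℤ_[p] (fun q : Q => Quotient.out q)
    have hf : Function.Surjective f := by
      apply surjective_of_mkQ_comp_surjective (I := I)
      intro q
      classical
      refine ⟨Pi.single q 1, ?_⟩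
      simp only [f, LinearMap.comp_apply, Fintype.linearCombination_apply_single, one_smul]
      exact Quotient.out_eq q
    exact Module.Finite.of_surjective f hf
end

section
/- Let N be a positive squarefree integer divisible by at least one odd prime. Let S be the set of prime numbers ℓ such that ℓ does not divide 2N, the Legendre symbol (-N | ℓ) equals -1 (i.e., ℓ is inert in ℚ(√-N)), and ℓ ≡ 3 or 5 (mod 8). Then S has natural density 1/4. -/
open Filter

/-- The number of primes `ℓ ∈ S` with `ℓ ≤ X`. -/
noncomputable def primeCount (S : Set ℕ) (X : ℝ) : ℕ :=
  Nat.card {p : ℕ | p.Prime ∧ p ∈ S ∧ (p : ℝ) ≤ X}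

/-- The prime counting function `π(X)`. -/
noncomputable def primePi (X : ℝ) : ℕ :=
  Nat.card {p : ℕ | p.Prime ∧ (p : ℝ) ≤ X}

/-- A set `S` of primes has natural density `δ` if `S(X)/π(X) → δ` as `X → ∞`. -/
def HasPrimeDensity (S : Set ℕ) (δ : ℝ) : Prop :=
  Tendsto (fun X : ℝ => (primeCount S X : ℝ) / (primePi X : ℝ)) atTop (nhds δ)

open MeasureTheory Topology

noncomputable def wiTent (t : ℝ) : ℝ := max 0 (1 - |t|)

noncomputable def wiD (v : ℝ) : ℝ := (Real.sinc (v / 2)) ^ 2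

lemma wiTent_cont : Continuous wiTent := by unfold wiTent; fun_prop

lemma wiTent_nonneg (t : ℝ) : 0 ≤ wiTent t := le_max_left _ _

lemma wiTent_supp {t : ℝ} (ht : t ∉ Set.Icc (-1 : ℝ) 1) : wiTent t = 0 := by
  unfold wiTent
  apply max_eq_left
  by_contra h
  push Not at h
  apply ht
  have : |t| ≤ 1 := by linarith
  exact abs_le.mp this

lemma wiTent_compact : HasCompactSupport wiTent :=
  HasCompactSupport.intro isCompact_Icc (fun _ h => wiTent_supp h)

lemma wiTent_int : Integrable wiTent := wiTent_cont.integrable_of_hasCompactSupport wiTent_compact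

lemma wiD_cont : Continuous wiD := by
  unfold wiD
  exact (Real.continuous_sinc.comp (continuous_id.div_const 2)).pow 2

lemma wiD_nonneg (v : ℝ) : 0 ≤ wiD v := sq_nonneg _

lemma wiD_le (v : ℝ) : wiD v ≤ 8 * (1 + v ^ 2)⁻¹ := by
  rw [← div_eq_mul_inv, le_div_iff₀ (by positivity)]
  have h1 : wiD v ≤ 1 := by
    unfold wiD
    rw [sq_le_one_iff_abs_le_one]; exact Real.abs_sinc_le_one _
  have h2 : wiD v * v ^ 2 ≤ 4 := by
    by_cases hv : v = 0
    · simp [hv]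
    · unfold wiD
      rw [Real.sinc_of_ne_zero (by simpa using hv)]
      have : (Real.sin (v / 2) / (v / 2)) ^ 2 * v ^ 2 = 4 * Real.sin (v / 2) ^ 2 := by
        field_simp; ring
      rw [this]
      nlinarith [Real.sin_sq_le_one (v / 2)]
  nlinarith

lemma wiD_int : Integrable wiD := by
  refine (integrable_inv_one_add_sq.const_mul 8).mono' wiD_cont.aestronglyMeasurable ?_
  filter_upwards with v
  rw [Real.norm_of_nonneg (wiD_nonneg v)]
  exact wiD_le v

lemma wiD_integral_pos : 0 < ∫ v, wiD v := by
  apply integral_pos_of_integrable_nonneg_nonzero (x := 0) wiD_cont wiD_int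
  · intro v; exact wiD_nonneg v
  · simp [wiD]

lemma wiD_eq (v : ℝ) : (wiD v : ℂ) = ∫ t : ℝ, (wiTent t : ℂ) * Complex.exp (-(Complex.I * t * v)) := by
  have e0 : ∫ t : ℝ, (wiTent t : ℂ) * Complex.exp (-(Complex.I * t * v))
      = ∫ t in (-1 : ℝ)..1, (wiTent t : ℂ) * Complex.exp (-(Complex.I * t * v)) := by
    rw [intervalIntegral.integral_of_le (by norm_num), ← integral_Icc_eq_integral_Ioc,
      setIntegral_eq_integral_of_forall_compl_eq_zero]
    intro t ht
    simp [wiTent_supp ht]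
  have hc : Continuous (fun t : ℝ => (wiTent t : ℂ) * Complex.exp (-(Complex.I * t * v))) := by
    have := wiTent_cont
    fun_prop
  have e1 : ∫ t in (-1 : ℝ)..1, (wiTent t : ℂ) * Complex.exp (-(Complex.I * t * v)) =
      (∫ t in (-1 : ℝ)..0, (1 + t : ℂ) * Complex.exp (-(Complex.I * t * v))) +
      ∫ t in (0 : ℝ)..1, (1 - t : ℂ) * Complex.exp (-(Complex.I * t * v)) := by
    rw [← intervalIntegral.integral_add_adjacent_intervals (b := 0)
      (hc.intervalIntegrable _ _) (hc.intervalIntegrable _ _)]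
    congr 1
    · apply intervalIntegral.integral_congr
      intro t ht
      rw [Set.uIcc_of_le (by norm_num)] at ht
      simp only [wiTent]
      rw [max_eq_right, abs_of_nonpos ht.2]
      · push_cast; ring
      · rw [abs_of_nonpos ht.2]; linarith [ht.1]
    · apply intervalIntegral.integral_congr
      intro t ht
      rw [Set.uIcc_of_le (by norm_num)] at ht
      simp only [wiTent]
      rw [max_eq_right, abs_of_nonneg ht.1]
      · push_cast; ring
      · rw [abs_of_nonneg ht.1]; linarith [ht.2]
  rw [e0, e1]
  by_cases hv : v = 0
  · subst hv
    simp only [wiD, Complex.ofReal_zero, mul_zero, neg_zero, Complex.exp_zero, mul_one]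
    have a1 : ∫ t in (-1 : ℝ)..0, (1 + t : ℂ) = ((1 / 2 : ℝ) : ℂ) := by
      have : ∫ t in (-1 : ℝ)..0, (1 + t : ℝ) = 1 / 2 := by
        rw [intervalIntegral.integral_add (by simp) (by simp)]
        simp; norm_num
      rw [← this, ← intervalIntegral.integral_ofReal]; simp
    have a2 : ∫ t in (0 : ℝ)..1, (1 - t : ℂ) = ((1 / 2 : ℝ) : ℂ) := by
      have : ∫ t in (0 : ℝ)..1, (1 - t : ℝ) = 1 / 2 := by
        rw [intervalIntegral.integral_sub (by simp) (by simp)]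
        simp; norm_num
      rw [← this, ← intervalIntegral.integral_ofReal]; simp
    rw [a1, a2]; simp; norm_num
  · set a : ℂ := -(Complex.I * v) with ha
    have hvc : (v : ℂ) ≠ 0 := by exact_mod_cast hv
    have ha0 : a ≠ 0 := by simp [ha, hv]
    have hexp : ∀ t : ℝ, Complex.exp (-(Complex.I * t * v)) = Complex.exp (a * t) := by
      intro t; rw [ha]; congr 1; ring
    simp_rw [hexp]
    have hE : ∀ x : ℝ, HasDerivAt (fun t : ℝ => Complex.exp (a * t)) (a * Complex.exp (a * x)) x := by
      intro x
      have : HasDerivAt (fun t : ℝ => a * (t : ℂ)) (a * 1) x :=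
        (Complex.ofRealCLM.hasDerivAt (x := x)).const_mul a
      have := this.cexp
      convert this using 1; ring
    have hO : ∀ x : ℝ, HasDerivAt (fun t : ℝ => (t : ℂ)) 1 x := fun x =>
      (Complex.ofRealCLM.hasDerivAt (x := x))
    have b1 : ∫ t in (-1 : ℝ)..0, (1 + t : ℂ) * Complex.exp (a * t) =
        1 / a - 1 / a ^ 2 + Complex.exp (-a) / a ^ 2 := by
      rw [intervalIntegral.integral_eq_sub_of_hasDerivAt
        (f := fun t : ℝ => (1 + t : ℂ) * Complex.exp (a * t) / a - Complex.exp (a * t) / a ^ 2)]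
      · simp
        try ring
      · intro x _
        have := ((((hO x).const_add 1).mul (hE x)).div_const a).sub ((hE x).div_const (a ^ 2))
        refine HasDerivAt.congr_deriv this ?_
        field_simp
        try ring
      · apply Continuous.intervalIntegrable; fun_prop
    have b2 : ∫ t in (0 : ℝ)..1, (1 - t : ℂ) * Complex.exp (a * t) =
        Complex.exp a / a ^ 2 - 1 / a - 1 / a ^ 2 := by
      rw [intervalIntegral.integral_eq_sub_of_hasDerivAt
        (f := fun t : ℝ => (1 - t : ℂ) * Complex.exp (a * t) / a + Complex.exp (a * t) / a ^ 2)]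
      · simp; ring
      · intro x _
        have := ((((hO x).const_sub 1).mul (hE x)).div_const a).add ((hE x).div_const (a ^ 2))
        refine HasDerivAt.congr_deriv this ?_
        field_simp
        try ring
      · apply Continuous.intervalIntegrable; fun_prop
    rw [b1, b2]
    have ha2 : a ^ 2 = -(v : ℂ) ^ 2 := by
      rw [ha]; ring_nf; simp
    have hcos : Complex.exp a + Complex.exp (-a) = 2 * Complex.cos v := by
      rw [Complex.two_cos, ha]; ring_nf
    have hD : (wiD v : ℂ) = 2 * (1 - Complex.cos v) / v ^ 2 := by
      unfold wiD
      rw [Real.sinc_of_ne_zero (by simpa using hv)]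
      have h2 : (Real.sin (v / 2)) ^ 2 = (1 - Real.cos v) / 2 := by
        rw [Real.sin_sq_eq_half_sub]; ring_nf
      have : (Real.sin (v / 2) / (v / 2)) ^ 2 = 2 * (1 - Real.cos v) / v ^ 2 := by
        rw [div_pow, h2]; field_simp; try norm_num
      rw [this]; push_cast; ring
    rw [hD]
    have : 1 / a - 1 / a ^ 2 + Complex.exp (-a) / a ^ 2 + (Complex.exp a / a ^ 2 - 1 / a - 1 / a ^ 2)
      = ((Complex.exp a + Complex.exp (-a)) - 2) / a ^ 2 := by ring
    rw [this, hcos, ha2]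
    field_simp; ring

lemma wi_exp_int {b : ℝ → ℝ} (hbm : Measurable b) {C : ℝ} (hb : ∀ u, |b u| ≤ C)
    (hb0 : ∀ u < 0, b u = 0) {σ : ℝ} (hσ : 0 < σ) :
    Integrable (fun u => b u * Real.exp (-σ * u)) := by
  have h1 : IntegrableOn (fun u => C * Real.exp (-σ * u)) (Set.Ici 0) := by
    rw [integrableOn_Ici_iff_integrableOn_Ioi]
    exact (exp_neg_integrableOn_Ioi 0 hσ).const_mul C
  have h2 := h1.integrable_indicator measurableSet_Ici
  refine h2.mono' (by fun_prop) ?_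
  filter_upwards with u
  by_cases hu : u < 0
  · simp [hb0 u hu, hu]
  · rw [Set.indicator_of_mem (by simpa using hu), norm_mul, Real.norm_eq_abs, Real.norm_eq_abs,
      Real.abs_exp]
    exact mul_le_mul_of_nonneg_right (hb u) (Real.exp_nonneg _)

lemma wi_step1 {b : ℝ → ℝ} (hbm : Measurable b) {C : ℝ} (hb : ∀ u, |b u| ≤ C)
    (hb0 : ∀ u < 0, b u = 0) {H : ℂ → ℂ}
    (hHe : ∀ σ : ℝ, 0 < σ → ∀ t : ℝ,
      ∫ u : ℝ, (b u : ℂ) * Complex.exp (-((σ + Complex.I * t) * u)) = H (σ + Complex.I * t))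
    (R y : ℝ) {σ : ℝ} (hσ : 0 < σ) :
    ∫ u : ℝ, ((b u * Real.exp (-σ * u) * wiD (R * (u - y)) : ℝ) : ℂ) =
      ∫ t : ℝ, (wiTent t : ℂ) * Complex.exp (Complex.I * t * R * y) *
        H (σ + Complex.I * (R * t : ℝ)) := by
  have e1 : ∀ u : ℝ, ((b u * Real.exp (-σ * u) * wiD (R * (u - y)) : ℝ) : ℂ) =
      ∫ t : ℝ, ((b u * Real.exp (-σ * u) : ℝ) : ℂ) *
        ((wiTent t : ℂ) * Complex.exp (-(Complex.I * t * (R * (u - y) : ℝ)))) := by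
    intro u
    rw [integral_const_mul, ← wiD_eq]
    push_cast; ring
  simp_rw [e1]
  rw [integral_integral_swap]
  · congr 1
    ext t
    rw [← hHe σ hσ, ← integral_const_mul]
    congr 1
    ext u
    have : Complex.exp (-(Complex.I * t * (R * (u - y) : ℝ))) * Complex.exp (-σ * u) =
        Complex.exp (Complex.I * t * R * y) *
          Complex.exp (-((σ + Complex.I * (R * t : ℝ)) * u)) := by
      rw [← Complex.exp_add, ← Complex.exp_add]
      congr 1
      push_cast; ring
    calc _ = (b u : ℂ) * wiTent t * (Complex.exp (-(Complex.I * t * (R * (u - y) : ℝ))) *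
          Complex.exp (-σ * u)) := by push_cast; ring
      _ = _ := by rw [this]; ring
  · have hi : Integrable (fun z : ℝ × ℝ => (b z.1 * Real.exp (-σ * z.1)) * wiTent z.2)
        (volume.prod volume) := (wi_exp_int hbm hb hb0 hσ).mul_prod wiTent_int
    have hc := wiTent_cont.measurable
    refine hi.norm.mono' ?_ ?_
    · apply Measurable.aestronglyMeasurable
      unfold Function.uncurry
      fun_prop
    · filter_upwards with z
      simp only [Function.uncurry]
      rw [norm_mul, norm_mul, norm_mul]
      have : ‖Complex.exp (-(Complex.I * z.2 * (R * (z.1 - y) : ℝ)))‖ = 1 := by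
        rw [Complex.norm_exp]; simp
      rw [this, Complex.norm_real, Complex.norm_real]
      simp

lemma wi_step2 {b : ℝ → ℝ} (hbm : Measurable b) {C : ℝ} (hb : ∀ u, |b u| ≤ C)
    (hb0 : ∀ u < 0, b u = 0) {H : ℂ → ℂ} (hH : ContinuousOn H {s | 0 ≤ s.re})
    (hHe : ∀ σ : ℝ, 0 < σ → ∀ t : ℝ,
      ∫ u : ℝ, (b u : ℂ) * Complex.exp (-((σ + Complex.I * t) * u)) = H (σ + Complex.I * t))
    {R : ℝ} (hR : 0 < R) (y : ℝ) :
    ∫ u : ℝ, ((b u * wiD (R * (u - y)) : ℝ) : ℂ) =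
      ∫ t : ℝ, (wiTent t : ℂ) * Complex.exp (Complex.I * t * R * y) *
        H (Complex.I * (R * t : ℝ)) := by
  have hDm := wiD_cont.measurable
  have hDi : Integrable (fun u => wiD (R * (u - y))) :=
    (wiD_int.comp_mul_left' hR.ne').comp_sub_right y
  have hC : 0 ≤ C := (abs_nonneg _).trans (hb 0)
  have L1 : Tendsto (fun σ : ℝ => ∫ u : ℝ, ((b u * Real.exp (-σ * u) * wiD (R * (u - y)) : ℝ) : ℂ))
      (𝓝[>] 0) (𝓝 (∫ u : ℝ, ((b u * wiD (R * (u - y)) : ℝ) : ℂ))) := by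
    apply tendsto_integral_filter_of_dominated_convergence (fun u => C * wiD (R * (u - y)))
    · filter_upwards with σ
      apply Measurable.aestronglyMeasurable
      fun_prop
    · filter_upwards [self_mem_nhdsWithin] with σ hσ
      filter_upwards with u
      rw [Complex.norm_real, norm_mul, Real.norm_of_nonneg (wiD_nonneg _)]
      apply mul_le_mul_of_nonneg_right _ (wiD_nonneg _)
      by_cases hu : u < 0
      · simp [hb0 u hu, hC]
      · rw [norm_mul, Real.norm_eq_abs, Real.norm_eq_abs, Real.abs_exp]
        have : Real.exp (-σ * u) ≤ 1 := by
          rw [Real.exp_le_one_iff]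
          have : 0 ≤ σ * u := mul_nonneg (le_of_lt hσ) (not_lt.mp hu)
          linarith
        calc |b u| * Real.exp (-σ * u) ≤ |b u| * 1 := by gcongr
          _ ≤ C := by simpa using hb u
    · exact hDi.const_mul C
    · filter_upwards with u
      have : Continuous (fun σ : ℝ => ((b u * Real.exp (-σ * u) * wiD (R * (u - y)) : ℝ) : ℂ)) := by
        fun_prop
      have := this.tendsto 0
      simp only [neg_zero, zero_mul, Real.exp_zero, mul_one] at this
      exact this.mono_left nhdsWithin_le_nhds
  -- bound on the compact rectangle
  have hcpt : IsCompact ((fun p : ℝ × ℝ => ((p.1 : ℂ) + Complex.I * (R * p.2 : ℝ))) ''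
      (Set.Icc (0 : ℝ) 1 ×ˢ Set.Icc (-1 : ℝ) 1)) := by
    apply (isCompact_Icc.prod isCompact_Icc).image
    fun_prop
  obtain ⟨M, hM⟩ := hcpt.exists_bound_of_continuousOn (f := H) (hH.mono (by
    rintro _ ⟨p, hp, rfl⟩
    simpa using hp.1.1))
  have hM0 : 0 ≤ M := by
    refine (norm_nonneg _).trans (hM _ ⟨(0, 0), by simp, rfl⟩)
  have hmH : ∀ σ : ℝ, 0 ≤ σ → Continuous (fun t : ℝ => H (σ + Complex.I * (R * t : ℝ))) := by
    intro σ hσ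
    rw [← continuousOn_univ]
    refine hH.comp (by fun_prop) ?_
    intro t _
    simpa using hσ
  have L2 : Tendsto (fun σ : ℝ => ∫ t : ℝ, (wiTent t : ℂ) * Complex.exp (Complex.I * t * R * y) *
        H (σ + Complex.I * (R * t : ℝ))) (𝓝[>] 0)
      (𝓝 (∫ t : ℝ, (wiTent t : ℂ) * Complex.exp (Complex.I * t * R * y) *
        H (Complex.I * (R * t : ℝ)))) := by
    apply tendsto_integral_filter_of_dominated_convergence (fun t => wiTent t * M)
    · filter_upwards [self_mem_nhdsWithin] with σ hσ
      have := hmH σ (le_of_lt hσ)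
      have h2 := wiTent_cont
      apply Continuous.aestronglyMeasurable
      exact Continuous.mul (by fun_prop) this
    · filter_upwards [Ioo_mem_nhdsGT (zero_lt_one' ℝ)] with σ hσ
      filter_upwards with t
      by_cases ht : t ∈ Set.Icc (-1 : ℝ) 1
      · rw [norm_mul, norm_mul]
        have : ‖Complex.exp (Complex.I * t * R * y)‖ = 1 := by
          rw [Complex.norm_exp]; simp
        rw [this, Complex.norm_real, Real.norm_of_nonneg (wiTent_nonneg t), mul_one]
        apply mul_le_mul_of_nonneg_left _ (wiTent_nonneg t)
        exact hM _ ⟨(σ, t), ⟨⟨hσ.1.le, hσ.2.le⟩, ht⟩, rfl⟩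
      · simp [wiTent_supp ht]
    · exact wiTent_int.mul_const M
    · filter_upwards with t
      apply Tendsto.const_mul
      have h0 : ContinuousWithinAt H {s | 0 ≤ s.re} (((0 : ℝ) : ℂ) + Complex.I * (R * t : ℝ)) :=
        hH _ (by simp)
      have h1 : Tendsto (fun σ : ℝ => (σ : ℂ) + Complex.I * (R * t : ℝ)) (𝓝[>] 0)
          (𝓝[{s | 0 ≤ s.re}] (((0 : ℝ) : ℂ) + Complex.I * (R * t : ℝ))) := by
        apply tendsto_nhdsWithin_of_tendsto_nhds_of_eventually_within
        · have : Continuous (fun σ : ℝ => (σ : ℂ) + Complex.I * (R * t : ℝ)) := by fun_prop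
          exact (this.tendsto 0).mono_left nhdsWithin_le_nhds
        · filter_upwards [self_mem_nhdsWithin] with σ hσ
          simpa using le_of_lt hσ
      have := h0.tendsto.comp h1
      simpa [Function.comp_def] using this
  refine tendsto_nhds_unique L1 (L2.congr' ?_)
  filter_upwards [self_mem_nhdsWithin] with σ hσ
  exact (wi_step1 hbm hb hb0 hHe R y hσ).symm

lemma wi_core {b : ℝ → ℝ} (hbm : Measurable b) {C : ℝ} (hb : ∀ u, |b u| ≤ C)
    (hb0 : ∀ u < 0, b u = 0) {H : ℂ → ℂ} (hH : ContinuousOn H {s | 0 ≤ s.re})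
    (hHe : ∀ σ : ℝ, 0 < σ → ∀ t : ℝ,
      ∫ u : ℝ, (b u : ℂ) * Complex.exp (-((σ + Complex.I * t) * u)) = H (σ + Complex.I * t))
    {R : ℝ} (hR : 0 < R) :
    Tendsto (fun y : ℝ => ∫ u : ℝ, b u * wiD (R * (u - y))) atTop (𝓝 0) := by
  have RL := Real.tendsto_integral_exp_smul_cocompact
    (fun t : ℝ => (wiTent t : ℂ) * H (Complex.I * (R * t : ℝ)))
  have hw : Tendsto (fun y : ℝ => -(R / (2 * Real.pi)) * y) atTop (cocompact ℝ) := by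
    refine Tendsto.mono_right ?_ atBot_le_cocompact
    exact tendsto_id.const_mul_atTop_of_neg (by
      have := Real.pi_pos
      have : 0 < R / (2 * Real.pi) := by positivity
      linarith)
  have h := RL.comp hw
  have hc : Tendsto (fun y : ℝ => ((∫ u : ℝ, b u * wiD (R * (u - y)) : ℝ) : ℂ)) atTop (𝓝 0) := by
    refine h.congr ?_
    intro y
    rw [← integral_complex_ofReal, wi_step2 hbm hb hb0 hH hHe hR y]
    simp only [Function.comp]
    congr 1
    ext t
    rw [Circle.smul_def, Real.fourierChar_apply, smul_eq_mul]
    have : Complex.exp ((2 * Real.pi * (-(t * (-(R / (2 * Real.pi)) * y))) : ℝ) * Complex.I)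
        = Complex.exp (Complex.I * t * R * y) := by
      congr 1
      have : (2 * Real.pi * (-(t * (-(R / (2 * Real.pi)) * y))) : ℝ) = t * R * y := by
        have := Real.pi_pos.ne'
        field_simp
      rw [this]; push_cast; ring
    rw [this]; ring
  have := (Complex.continuous_re.tendsto 0).comp hc
  simpa [Function.comp_def] using this

lemma wi_change (g : ℝ → ℝ) {R : ℝ} (hR : 0 < R) (y : ℝ) :
    ∫ v : ℝ, g (y + v / R) * wiD v = R * ∫ u : ℝ, g u * wiD (R * (u - y)) := by
  have h1 : ∫ u : ℝ, g u * wiD (R * (u - y)) = ∫ u : ℝ, g (y + u) * wiD (R * u) := by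
    rw [← integral_sub_right_eq_self (fun u => g (y + u) * wiD (R * u)) y]
    simp
  have h2 := Measure.integral_comp_mul_left (fun v => g (y + v / R) * wiD v) R
  have h3 : ∀ x : ℝ, R * x / R = x := fun x => by field_simp
  simp only [h3, smul_eq_mul] at h2
  rw [h1, h2, abs_of_pos (inv_pos.mpr hR), ← mul_assoc, mul_inv_cancel₀ hR.ne', one_mul]

lemma wi_smooth {B : ℝ → ℝ} (hBm : Measurable B) {C : ℝ} (hB0 : ∀ u, 0 ≤ B u)
    (hBC : ∀ u, B u ≤ C) {c : ℝ} {R : ℝ} (hR : 0 < R)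
    (hT : Tendsto (fun y : ℝ => ∫ u : ℝ, (B u - if u < 0 then 0 else c) * wiD (R * (u - y)))
      atTop (𝓝 0)) :
    Tendsto (fun y : ℝ => ∫ v : ℝ, B (y + v / R) * wiD v) atTop (𝓝 (c * ∫ v, wiD v)) := by
  have hDm := wiD_cont.measurable
  have h1 := hT.const_mul R
  simp_rw [← wi_change (fun u => B u - if u < 0 then 0 else c) hR] at h1
  have h2 : Tendsto (fun y : ℝ => ∫ v : ℝ, (if y + v / R < 0 then 0 else c) * wiD v) atTop
      (𝓝 (∫ v : ℝ, c * wiD v)) := by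
    apply tendsto_integral_filter_of_dominated_convergence (fun v => |c| * wiD v)
    · filter_upwards with y
      apply Measurable.aestronglyMeasurable
      apply Measurable.mul _ hDm
      apply Measurable.ite _ measurable_const measurable_const
      exact measurableSet_lt (by fun_prop) measurable_const
    · filter_upwards with y
      filter_upwards with v
      rw [norm_mul, Real.norm_of_nonneg (wiD_nonneg _)]
      apply mul_le_mul_of_nonneg_right _ (wiD_nonneg _)
      split_ifs <;> simp
    · exact wiD_int.const_mul _
    · filter_upwards with v
      apply tendsto_const_nhds.congr'
      filter_upwards [eventually_ge_atTop (-(v / R))] with y hy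
      rw [if_neg (by linarith)]
  rw [integral_const_mul] at h2
  have h3 := h1.add h2
  rw [mul_zero, zero_add] at h3
  refine h3.congr ?_
  intro y
  have hm : Measurable (fun v : ℝ => (if y + v / R < 0 then 0 else c)) := by
    apply Measurable.ite _ measurable_const measurable_const
    exact measurableSet_lt (by fun_prop) measurable_const
  have i1 : Integrable (fun v : ℝ => B (y + v / R) * wiD v) := by
    apply wiD_int.bdd_mul (c := C)
          (Measurable.aestronglyMeasurable (by fun_prop))
    filter_upwards with v
    rw [Real.norm_of_nonneg (hB0 _)]; exact hBC _
  have i2 : Integrable (fun v : ℝ => (if y + v / R < 0 then 0 else c) * wiD v) := by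
    apply wiD_int.bdd_mul (c := |c|) hm.aestronglyMeasurable
    filter_upwards with v
    split_ifs <;> simp
  rw [← integral_add]
  · congr 1
    ext v; ring
  · simp_rw [sub_mul]
    exact i1.sub i2
  · exact i2

lemma wi_final {B : ℝ → ℝ} (hBm : Measurable B) {C : ℝ} (hB0 : ∀ u, 0 ≤ B u)
    (hBC : ∀ u, B u ≤ C) (hmono : ∀ u v, u ≤ v → B u ≤ Real.exp (v - u) * B v) {c : ℝ}
    (hT : ∀ R : ℝ, 0 < R →
      Tendsto (fun y : ℝ => ∫ u : ℝ, (B u - if u < 0 then 0 else c) * wiD (R * (u - y)))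
      atTop (𝓝 0)) :
    Tendsto B atTop (𝓝 c) := by
  set I := ∫ v, wiD v with hI
  have hI0 : 0 < I := wiD_integral_pos
  have hC0 : 0 ≤ C := (hB0 0).trans (hBC 0)
  have key : ∀ ε : ℝ, 0 < ε → ∃ R : ℝ, 0 < R ∧ ∃ J : ℝ, J ≤ I ∧ I - ε ≤ J ∧ 
      (∀ y, Real.exp (-(2 * ε)) * B (y - ε) * J ≤ ∫ v : ℝ, B (y + v / R) * wiD v) ∧
      (∀ y, ∫ v : ℝ, B (y + v / R) * wiD v ≤ 
        Real.exp (2 * ε) * B (y + ε) * J + C * (I - J)) := by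
    intro ε hε
    have ht := intervalIntegral_tendsto_integral wiD_int tendsto_neg_atTop_atBot
      (tendsto_id (α := ℝ) (x := atTop))
    have hev := (ht.eventually (lt_mem_nhds (show I - ε < I by linarith))).and
      (eventually_ge_atTop 1)
    obtain ⟨M, hM, hM1⟩ := hev.exists
    simp only [id] at hM
    rw [intervalIntegral.integral_of_le (by linarith), ← integral_Icc_eq_integral_Ioc] at hM
    have hMR : 0 < M / ε := by positivity
    have hsplit : ∀ (g : ℝ → ℝ), Integrable g →
        (∫ v in Set.Icc (-M) M, g v) + (∫ v in (Set.Icc (-M) M)ᶜ, g v) = ∫ v, g v :=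
      fun g hg => integral_add_compl measurableSet_Icc hg
    have hloc : ∀ v ∈ Set.Icc (-M) M, -ε ≤ v / (M / ε) ∧ v / (M / ε) ≤ ε := by
      intro v hv
      have hM0 : 0 < M := by linarith
      constructor
      · rw [le_div_iff₀ hMR]
        have : -ε * (M / ε) = -M := by field_simp
        rw [this]; exact hv.1
      · rw [div_le_iff₀ hMR]
        have : ε * (M / ε) = M := by field_simp
        rw [this]; exact hv.2
    have hint : ∀ y, Integrable (fun v : ℝ => B (y + v / (M / ε)) * wiD v) := by
      intro y
      apply wiD_int.bdd_mul (c := C)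
          (Measurable.aestronglyMeasurable (by fun_prop))
      filter_upwards with v
      rw [Real.norm_of_nonneg (hB0 _)]; exact hBC _
    refine ⟨M / ε, hMR, ∫ v in Set.Icc (-M) M, wiD v, ?_, hM.le, ?_, ?_⟩
    · exact setIntegral_le_integral wiD_int (ae_of_all _ wiD_nonneg)
    · intro y
      refine le_trans ?_ (setIntegral_le_integral (s := Set.Icc (-M) M) (hint y)
        (ae_of_all _ fun v => mul_nonneg (hB0 _) (wiD_nonneg v)))
      rw [← integral_const_mul]
      apply setIntegral_mono_on (wiD_int.const_mul _).integrableOn (hint y).integrableOn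
        measurableSet_Icc
      intro v hv
      apply mul_le_mul_of_nonneg_right _ (wiD_nonneg v)
      obtain ⟨h1, h2⟩ := hloc v hv
      have h3 := hmono (y - ε) (y + v / (M / ε)) (by linarith)
      have h4 : Real.exp (y + v / (M / ε) - (y - ε)) ≤ Real.exp (2 * ε) :=
        Real.exp_le_exp.mpr (by linarith)
      rw [Real.exp_neg, inv_mul_le_iff₀ (Real.exp_pos _)]
      exact h3.trans (mul_le_mul_of_nonneg_right h4 (hB0 _))
    · intro y
      rw [← hsplit _ (hint y)]
      have hIJ : I - ∫ v in Set.Icc (-M) M, wiD v = ∫ v in (Set.Icc (-M) M)ᶜ, wiD v := by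
        rw [hI, ← hsplit _ wiD_int]; ring
      rw [hIJ, ← integral_const_mul, ← integral_const_mul]
      apply add_le_add
      · apply setIntegral_mono_on (hint y).integrableOn (wiD_int.const_mul _).integrableOn
          measurableSet_Icc
        intro v hv
        apply mul_le_mul_of_nonneg_right _ (wiD_nonneg v)
        obtain ⟨h1, h2⟩ := hloc v hv
        have h3 := hmono (y + v / (M / ε)) (y + ε) (by linarith)
        have h4 : Real.exp (y + ε - (y + v / (M / ε))) ≤ Real.exp (2 * ε) :=
          Real.exp_le_exp.mpr (by linarith)
        exact h3.trans (mul_le_mul_of_nonneg_right h4 (hB0 _))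
      · apply setIntegral_mono_on (hint y).integrableOn (wiD_int.const_mul _).integrableOn
          measurableSet_Icc.compl
        intro v hv
        exact mul_le_mul_of_nonneg_right (hBC _) (wiD_nonneg v)
  rw [tendsto_order]
  constructor
  · intro c2 hc2
    have hlim : Tendsto (fun ε : ℝ => Real.exp (-(2 * ε)) * (c * I - ε - C * ε)) (𝓝[>] 0)
        (𝓝 (c * I)) := by
      have : Continuous (fun ε : ℝ => Real.exp (-(2 * ε)) * (c * I - ε - C * ε)) := by fun_prop
      have := this.tendsto 0
      simp only [mul_zero, neg_zero, Real.exp_zero, sub_zero, one_mul] at this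
      exact this.mono_left nhdsWithin_le_nhds
    obtain ⟨ε, h1, hε⟩ := ((hlim.eventually (lt_mem_nhds
      (show c2 * I < c * I from mul_lt_mul_of_pos_right hc2 hI0))).and self_mem_nhdsWithin).exists
    replace hε : 0 < ε := hε
    obtain ⟨R, hR, J, hJI, hJ, -, hup⟩ := key ε hε
    have hsm := wi_smooth hBm hB0 hBC hR (hT R hR)
    have hev := hsm.eventually (lt_mem_nhds (show c * I - ε < c * I by linarith))
    have hev2 := (tendsto_atTop_add_const_right atTop (-ε) tendsto_id).eventually hev
    filter_upwards [hev2] with y hy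
    simp only [id] at hy
    have h2 := hup (y + -ε)
    rw [neg_add_cancel_right] at h2
    have h3 : Real.exp (2 * ε) * B y * J ≤ Real.exp (2 * ε) * B y * I :=
      mul_le_mul_of_nonneg_left hJI (mul_nonneg (Real.exp_nonneg _) (hB0 _))
    have h4 : C * (I - J) ≤ C * ε := mul_le_mul_of_nonneg_left (by linarith) hC0
    have h5 : c * I - ε - C * ε < Real.exp (2 * ε) * (B y * I) := by
      rw [← mul_assoc]; linarith
    rw [Real.exp_neg, lt_inv_mul_iff₀ (Real.exp_pos _)] at h1
    have h6 := h1.trans h5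
    have h7 := lt_of_mul_lt_mul_left h6 (Real.exp_nonneg _)
    exact lt_of_mul_lt_mul_right h7 hI0.le
  · intro c1 hc1
    have hlim : Tendsto (fun ε : ℝ => Real.exp (2 * ε) * (c * I + ε) - c1 * (I - ε)) (𝓝[>] 0)
        (𝓝 (c * I - c1 * I)) := by
      have : Continuous (fun ε : ℝ => Real.exp (2 * ε) * (c * I + ε) - c1 * (I - ε)) := by fun_prop
      have := this.tendsto 0
      simp only [mul_zero, Real.exp_zero, sub_zero, add_zero, one_mul] at this
      exact this.mono_left nhdsWithin_le_nhds
    have hneg : c * I - c1 * I < 0 := by nlinarith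
    obtain ⟨ε, ⟨h1, hε⟩, hεI⟩ := (((hlim.eventually (gt_mem_nhds hneg)).and
      self_mem_nhdsWithin).and (mem_nhdsWithin_of_mem_nhds (Iio_mem_nhds hI0))).exists
    replace hε : 0 < ε := hε
    replace hεI : ε < I := hεI
    obtain ⟨R, hR, J, hJI, hJ, hlo, -⟩ := key ε hε
    have hsm := wi_smooth hBm hB0 hBC hR (hT R hR)
    have hev := hsm.eventually (gt_mem_nhds (show c * I < c * I + ε by linarith))
    have hev2 := (tendsto_atTop_add_const_right atTop ε tendsto_id).eventually hev
    filter_upwards [hev2] with y hy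
    simp only [id] at hy
    have h2 := hlo (y + ε)
    rw [add_sub_cancel_right, mul_assoc, Real.exp_neg, inv_mul_le_iff₀ (Real.exp_pos _)] at h2
    have h3 : B y * (I - ε) ≤ B y * J := mul_le_mul_of_nonneg_left hJ (hB0 _)
    have h4 := mul_lt_mul_of_pos_left hy (Real.exp_pos (2 * ε))
    have h5 : B y * (I - ε) < c1 * (I - ε) := by linarith
    exact lt_of_mul_lt_mul_right h5 (by linarith)

noncomputable def wiA (f : ℕ → ℝ) (x : ℝ) : ℝ := ∑ k ∈ Finset.Icc 1 ⌊x⌋₊, f k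

lemma wiA_mono {f : ℕ → ℝ} (hf : ∀ n, 0 ≤ f n) : Monotone (wiA f) := by
  intro x y hxy
  apply Finset.sum_le_sum_of_subset_of_nonneg
  · exact Finset.Icc_subset_Icc_right (Nat.floor_mono hxy)
  · intro i _ _; exact hf i

lemma wiA_nonneg {f : ℕ → ℝ} (hf : ∀ n, 0 ≤ f n) (x : ℝ) : 0 ≤ wiA f x :=
  Finset.sum_nonneg fun i _ => hf i

lemma wi_transform {f : ℕ → ℝ} (hf : ∀ n, 0 ≤ f n) {C : ℝ}
    (hC : ∀ x, 0 ≤ x → wiA f x ≤ C * x) {z : ℂ} (hz : 0 < z.re) :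
    ∫ u in Set.Ioi (0 : ℝ), ((wiA f (Real.exp u) * Real.exp (-u) : ℝ) : ℂ) * Complex.exp (-(z * u))
      = LSeries (fun n => (f n : ℂ)) (1 + z) / (1 + z) := by
  have hO : (fun n : ℕ ↦ ∑ k ∈ Finset.Icc 1 n, f k) =O[atTop] fun n ↦ (n : ℝ) ^ (1 : ℝ) := by
    apply Asymptotics.IsBigO.of_bound C
    filter_upwards with n
    have := hC n (Nat.cast_nonneg n)
    have h0 := wiA_nonneg hf n
    simp only [wiA, Nat.floor_natCast] at this h0
    rw [Real.rpow_one, Real.norm_of_nonneg h0, Real.norm_of_nonneg (Nat.cast_nonneg n)]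
    exact this
  have hne : (1 + z) ≠ 0 := by
    intro h
    have := congrArg Complex.re h
    simp at this; linarith
  rw [LSeries_eq_mul_integral_of_nonneg f zero_le_one (s := 1 + z) (by simpa using hz) hO hf,
    mul_div_cancel_left₀ _ hne]
  have himg : Real.exp '' Set.Ioi 0 = Set.Ioi 1 := by
    ext x
    constructor
    · rintro ⟨u, hu, rfl⟩
      exact Real.one_lt_exp_iff.mpr hu
    · intro hx
      have hx1 : (1 : ℝ) < x := hx
      exact ⟨Real.log x, Real.log_pos hx1, Real.exp_log (by linarith)⟩
  rw [← himg, integral_image_eq_integral_abs_deriv_smul measurableSet_Ioi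
    (fun x _ => (Real.hasDerivAt_exp x).hasDerivWithinAt) Real.exp_injective.injOn]
  apply setIntegral_congr_fun measurableSet_Ioi
  intro u _
  simp only [wiA]
  rw [Real.abs_exp, Complex.real_smul, Complex.cpow_def_of_ne_zero (by exact_mod_cast (Real.exp_pos u).ne'),
    ← Complex.ofReal_log (Real.exp_nonneg u), Real.log_exp]
  push_cast
  have : Complex.exp (-u) * Complex.exp (-(z * u)) =
      Complex.exp u * Complex.exp (u * -(1 + z + 1)) := by
    rw [← Complex.exp_add, ← Complex.exp_add]; congr 1; ring
  rw [mul_assoc, this]; ring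

theorem wienerIkehara {f : ℕ → ℝ} (hf : ∀ n, 0 ≤ f n) {C : ℝ}
    (hC : ∀ x, 0 ≤ x → wiA f x ≤ C * x) {c : ℝ} {G : ℂ → ℂ}
    (hG : ContinuousOn G {s | 1 ≤ s.re})
    (hGe : ∀ s : ℂ, 1 < s.re → G s = LSeries (fun n => (f n : ℂ)) s - c / (s - 1)) :
    Tendsto (fun x : ℝ => wiA f x / x) atTop (𝓝 c) := by
  set B : ℝ → ℝ := fun u => wiA f (Real.exp u) * Real.exp (-u) with hB
  have hAm : Measurable (wiA f) := (wiA_mono hf).measurable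
  have hBm : Measurable B := by fun_prop
  have hB0 : ∀ u, 0 ≤ B u := fun u => mul_nonneg (wiA_nonneg hf _) (Real.exp_nonneg _)
  have hBC : ∀ u, B u ≤ C := by
    intro u
    have := mul_le_mul_of_nonneg_right (hC _ (Real.exp_nonneg u)) (Real.exp_nonneg (-u))
    rwa [mul_assoc, ← Real.exp_add, add_neg_cancel, Real.exp_zero, mul_one] at this
  have hBz : ∀ u < 0, B u = 0 := by
    intro u hu
    have : ⌊Real.exp u⌋₊ = 0 := Nat.floor_eq_zero.mpr (Real.exp_lt_one_iff.mpr hu)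
    simp [hB, wiA, this]
  have hmono : ∀ u v, u ≤ v → B u ≤ Real.exp (v - u) * B v := by
    intro u v huv
    have h1 : Real.exp (v - u) * B v = wiA f (Real.exp v) * Real.exp (-u) := by
      simp only [hB]
      rw [mul_left_comm, ← Real.exp_add]; congr 2; ring
    rw [h1]
    exact mul_le_mul_of_nonneg_right (wiA_mono hf (Real.exp_le_exp.mpr huv)) (Real.exp_nonneg _)
  have hC0 : 0 ≤ C := (hB0 0).trans (hBC 0)
  set b : ℝ → ℝ := fun u => B u - if u < 0 then 0 else c with hb
  have hbm : Measurable b := by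
    apply hBm.sub
    exact Measurable.ite measurableSet_Iio measurable_const measurable_const
  have hbC : ∀ u, |b u| ≤ C + |c| := by
    intro u
    refine (abs_sub _ _).trans (add_le_add ?_ ?_)
    · rw [abs_of_nonneg (hB0 u)]; exact hBC u
    · split_ifs <;> simp
  have hbz : ∀ u < 0, b u = 0 := by
    intro u hu; simp [hb, hBz u hu, hu]
  have hlim : Tendsto B atTop (𝓝 c) := by
    apply wi_final hBm hB0 hBC hmono
    intro R hR
    apply wi_core hbm hbC hbz (H := fun z => (G (1 + z) - c) / (1 + z)) _ _ hR
    · apply ContinuousOn.div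
      · apply ContinuousOn.sub _ continuousOn_const
        apply hG.comp (by fun_prop)
        intro z hz
        simpa using hz
      · fun_prop
      · intro z hz h
        have := congrArg Complex.re h
        simp at this
        have h2 : 0 ≤ z.re := hz
        linarith
    · intro σ hσ t
      set z : ℂ := σ + Complex.I * t with hz
      have hzre : z.re = σ := by simp [hz]
      have hz0 : 0 < z.re := by rw [hzre]; exact hσ
      have hzne : z ≠ 0 := by intro h; rw [h] at hz0; simp at hz0
      have hz1 : 1 + z ≠ 0 := by
        intro h
        have := congrArg Complex.re h
        simp at this; linarith
      have e1 : ∫ u : ℝ, (b u : ℂ) * Complex.exp (-(z * u)) =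
          ∫ u in Set.Ioi (0 : ℝ), (b u : ℂ) * Complex.exp (-(z * u)) := by
        rw [← integral_Ici_eq_integral_Ioi, setIntegral_eq_integral_of_forall_compl_eq_zero]
        intro u hu
        rw [hbz u (by simpa using hu)]; simp
      have e2 : ∫ u in Set.Ioi (0 : ℝ), (b u : ℂ) * Complex.exp (-(z * u)) =
          ∫ u in Set.Ioi (0 : ℝ), ((B u : ℂ) * Complex.exp (-(z * u)) -
            c * Complex.exp (-z * u)) := by
        apply setIntegral_congr_fun measurableSet_Ioi
        intro u hu
        have hu' : ¬ u < 0 := not_lt.mpr (le_of_lt hu)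
        simp only [hb, if_neg hu']
        push_cast; ring_nf
      have i2 : IntegrableOn (fun u : ℝ => (c : ℂ) * Complex.exp (-z * u)) (Set.Ioi 0) :=
        (integrableOn_exp_mul_complex_Ioi (by simpa using hz0) 0).const_mul _
      have i1 : IntegrableOn (fun u : ℝ => (B u : ℂ) * Complex.exp (-(z * u))) (Set.Ioi 0) := by
        have h := (integrableOn_exp_mul_complex_Ioi (a := -z) (by simpa using hz0) 0)
        simp only [neg_mul] at h
        apply h.bdd_mul (c := C)
        · exact Measurable.aestronglyMeasurable (by fun_prop)
        · filter_upwards with u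
          rw [Complex.norm_real, Real.norm_of_nonneg (hB0 u)]; exact hBC u
      rw [e1, e2, integral_sub i1 i2, wi_transform hf hC hz0, integral_const_mul,
        integral_exp_mul_complex_Ioi (by simpa using hz0), hGe (1 + z) (by simpa using hz0)]
      simp only [Complex.ofReal_zero, mul_zero, Complex.exp_zero, add_sub_cancel_left]
      field_simp
      ring
  have := hlim.comp Real.tendsto_log_atTop
  refine this.congr' ?_
  filter_upwards [eventually_gt_atTop 0] with x hx
  simp only [Function.comp, hB]
  rw [Real.exp_neg, Real.exp_log hx]
  rfl

open ArithmeticFunction in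
lemma wi_residue {q : ℕ} [NeZero q] {a : ZMod q} (ha : IsUnit a) :
    Tendsto (fun x : ℝ => wiA (vonMangoldt.residueClass a) x / x) atTop
      (𝓝 ((q.totient : ℝ)⁻¹)) := by
  refine wienerIkehara (vonMangoldt.residueClass_nonneg a) (C := Real.log 4 + 4) ?_
    (vonMangoldt.continuousOn_LFunctionResidueClassAux a) ?_
  · intro x hx
    refine le_trans ?_ (Chebyshev.psi_le_const_mul_self hx)
    unfold wiA Chebyshev.psi
    apply Finset.sum_le_sum
    intro i _
    exact vonMangoldt.residueClass_le a i
  · intro s hs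
    rw [vonMangoldt.eqOn_LFunctionResidueClassAux ha hs]
    simp

/-- weighted count of primes in a set of residue classes -/
noncomputable def wiTheta (P : ℕ → Prop) (x : ℝ) : ℝ :=
  by classical exact ∑ n ∈ (Finset.Icc 1 ⌊x⌋₊).filter (fun n => n.Prime ∧ P n), Real.log n

noncomputable def wiPi (P : ℕ → Prop) (x : ℝ) : ℕ :=
  by classical exact ((Finset.Icc 1 ⌊x⌋₊).filter (fun n => n.Prime ∧ P n)).card

open ArithmeticFunction in
lemma wi_theta {q : ℕ} [NeZero q] (T : Finset (ZMod q)) (hT : ∀ a ∈ T, IsUnit a) :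
    Tendsto (fun x : ℝ => wiTheta (fun n => (n : ZMod q) ∈ T) x / x) atTop
      (𝓝 ((T.card : ℝ) / q.totient)) := by
  classical
  have h1 : Tendsto (fun x : ℝ => ∑ a ∈ T, wiA (vonMangoldt.residueClass a) x / x) atTop
      (𝓝 (∑ a ∈ T, (q.totient : ℝ)⁻¹)) :=
    tendsto_finsetSum _ fun a ha => wi_residue (hT a ha)
  rw [Finset.sum_const, nsmul_eq_mul, ← div_eq_mul_inv] at h1
  have hA : ∀ x, ∑ a ∈ T, wiA (vonMangoldt.residueClass a) x =
      ∑ n ∈ Finset.Icc 1 ⌊x⌋₊, if (n : ZMod q) ∈ T then Λ n else 0 := by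
    intro x
    unfold wiA
    rw [Finset.sum_comm]
    apply Finset.sum_congr rfl
    intro n _
    simp [vonMangoldt.residueClass, Set.indicator_apply]
  have hth : ∀ x, wiTheta (fun n => (n : ZMod q) ∈ T) x =
      ∑ n ∈ Finset.Icc 1 ⌊x⌋₊, if n.Prime ∧ (n : ZMod q) ∈ T then Λ n else 0 := by
    intro x
    unfold wiTheta
    rw [Finset.sum_filter]
    apply Finset.sum_congr rfl
    intro n _
    split_ifs with h
    · rw [vonMangoldt_apply_prime h.1]
    · rfl
  have hd : ∀ x, |∑ a ∈ T, wiA (vonMangoldt.residueClass a) x -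
      wiTheta (fun n => (n : ZMod q) ∈ T) x| ≤ Chebyshev.psi x - Chebyshev.theta x := by
    intro x
    rw [hA, hth, Chebyshev.psi_sub_theta_eq_sum_not_prime, ← Finset.sum_sub_distrib, abs_of_nonneg]
    · rw [Finset.sum_filter]
      apply Finset.sum_le_sum
      intro n _
      have := vonMangoldt_nonneg (n := n)
      by_cases hp : n.Prime <;> by_cases hm : (n : ZMod q) ∈ T <;> simp [hp, hm, this]
    · apply Finset.sum_nonneg
      intro n _
      have := vonMangoldt_nonneg (n := n)
      by_cases hp : n.Prime <;> by_cases hm : (n : ZMod q) ∈ T <;> simp [hp, hm, this]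
  obtain ⟨C, hC⟩ := Chebyshev.psi_sub_theta_le_mul_sqrt
  have h2 : Tendsto (fun x : ℝ => (∑ a ∈ T, wiA (vonMangoldt.residueClass a) x -
      wiTheta (fun n => (n : ZMod q) ∈ T) x) / x) atTop (𝓝 0) := by
    have hs : Tendsto (fun x : ℝ => C * (√x)⁻¹) atTop (𝓝 (C * 0)) :=
      (Real.tendsto_sqrt_atTop.inv_tendsto_atTop).const_mul C
    rw [mul_zero] at hs
    apply squeeze_zero_norm' _ hs
    filter_upwards [eventually_gt_atTop 0] with x hx
    rw [norm_div, Real.norm_of_nonneg hx.le, Real.norm_eq_abs, div_le_iff₀ hx]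
    refine (hd x).trans ((hC x).trans (le_of_eq ?_))
    have : 0 < √x := Real.sqrt_pos.mpr hx
    nth_rewrite 3 [← Real.mul_self_sqrt hx.le]
    field_simp
  have h3 := h1.sub h2
  rw [sub_zero] at h3
  refine h3.congr ?_
  intro x
  rw [← Finset.sum_div]; ring

lemma wi_pi {P : ℕ → Prop} {c : ℝ} (h : Tendsto (fun x : ℝ => wiTheta P x / x) atTop (𝓝 c)) :
    Tendsto (fun x : ℝ => wiPi P x * Real.log x / x) atTop (𝓝 c) := by
  classical
  have hlog := Real.tendsto_log_atTop
  have hll : Tendsto (fun L : ℝ => Real.log L / L) atTop (𝓝 0) :=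
    Real.isLittleO_log_id_atTop.tendsto_div_nhds_zero
  have hr : Tendsto (fun L : ℝ => L / (L - 2 * Real.log L)) atTop (𝓝 1) := by
    have h1 : Tendsto (fun L : ℝ => (1 - 2 * (Real.log L / L))⁻¹) atTop (𝓝 1) := by
      have := (tendsto_const_nhds (x := (1 : ℝ))).sub (hll.const_mul 2)
      rw [mul_zero, sub_zero] at this
      simpa using this.inv₀ one_ne_zero
    refine h1.congr' ?_
    filter_upwards [eventually_gt_atTop 0] with L hL
    have : 1 - 2 * (Real.log L / L) = (L - 2 * Real.log L) / L := by field_simp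
    rw [this, inv_div]
  have hpos : ∀ᶠ L : ℝ in atTop, 0 < L - 2 * Real.log L := by
    have : ∀ᶠ L : ℝ in atTop, Real.log L / L < 1 / 2 := hll.eventually (gt_mem_nhds (by norm_num))
    filter_upwards [this, eventually_gt_atTop 0] with L h1 h2
    rw [div_lt_iff₀ h2] at h1
    linarith
  have hup : Tendsto (fun x : ℝ => (Real.log x)⁻¹ +
      (wiTheta P x / x) * (Real.log x / (Real.log x - 2 * Real.log (Real.log x)))) atTop (𝓝 c) := by
    have := (hlog.inv_tendsto_atTop).add (h.mul (hr.comp hlog))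
    simpa using this
  refine tendsto_of_tendsto_of_tendsto_of_le_of_le' h hup ?_ ?_
  · filter_upwards [eventually_gt_atTop 1] with x hx
    apply div_le_div_of_nonneg_right _ (by linarith)
    unfold wiTheta wiPi
    rw [← nsmul_eq_mul]
    apply Finset.sum_le_card_nsmul
    intro n hn
    simp only [Finset.mem_filter, Finset.mem_Icc] at hn
    apply Real.log_le_log
    · exact_mod_cast hn.1.1
    · exact (Nat.le_floor_iff (by linarith)).mp hn.1.2
  · filter_upwards [eventually_gt_atTop 1, hlog.eventually hpos,
      hlog.eventually (eventually_gt_atTop 0)] with x hx hL hL0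
    set L := Real.log x with hLdef
    have hx0 : 0 < x := by linarith
    set y := x / L ^ 2 with hy
    have hy0 : 0 < y := by positivity
    have hlogy : Real.log y = L - 2 * Real.log L := by
      rw [hy, Real.log_div hx0.ne' (by positivity), Real.log_pow]; push_cast; ring
    rw [← hlogy] at hL ⊢
    have hmain : (wiPi P x : ℝ) ≤ y + wiTheta P x / Real.log y := by
      unfold wiPi wiTheta
      set F := (Finset.Icc 1 ⌊x⌋₊).filter (fun n => n.Prime ∧ P n) with hF
      rw [← Finset.card_filter_add_card_filter_not (fun n : ℕ => (n : ℝ) ≤ y)]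
      push_cast
      apply add_le_add
      · have : F.filter (fun n : ℕ => (n : ℝ) ≤ y) ⊆ Finset.Icc 1 ⌊y⌋₊ := by
          intro n hn
          simp only [hF, Finset.mem_filter, Finset.mem_Icc] at hn ⊢
          exact ⟨hn.1.1.1, Nat.le_floor hn.2⟩
        have := Finset.card_le_card this
        rw [Nat.card_Icc, Nat.add_sub_cancel] at this
        exact (Nat.cast_le.mpr this).trans (Nat.floor_le hy0.le)
      · rw [le_div_iff₀ hL]
        have h1 : ∑ n ∈ F.filter (fun n : ℕ => ¬ (n : ℝ) ≤ y), Real.log n ≤ ∑ n ∈ F, Real.log n := by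
          apply Finset.sum_le_sum_of_subset_of_nonneg (Finset.filter_subset _ _)
          intro n _ _
          exact Real.log_natCast_nonneg n
        refine le_trans ?_ h1
        rw [← nsmul_eq_mul]
        apply Finset.card_nsmul_le_sum
        intro n hn
        simp only [Finset.mem_filter] at hn
        exact Real.log_le_log hy0 (not_le.mp hn.2).le
    calc (wiPi P x : ℝ) * L / x ≤ (y + wiTheta P x / Real.log y) * L / x := by
          gcongr
      _ = _ := by
          rw [hy]; field_simp

lemma wi_density {q : ℕ} [NeZero q] (T : Finset (ZMod q)) (hT : ∀ a ∈ T, IsUnit a) :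
    Tendsto (fun x : ℝ => (wiPi (fun n => (n : ZMod q) ∈ T) x : ℝ) / wiPi (fun _ => True) x) atTop
      (𝓝 ((T.card : ℝ) / q.totient)) := by
  have h1 := wi_pi (wi_theta T hT)
  have h2 := wi_pi (wi_theta (q := 1) Finset.univ (fun a _ => by
    rw [Subsingleton.elim a 1]; exact isUnit_one))
  simp only [Finset.mem_univ, Finset.card_univ, ZMod.card, Nat.totient_one] at h2
  norm_num at h2
  have h3 := h1.div h2 one_ne_zero
  rw [div_one] at h3
  refine h3.congr' ?_
  filter_upwards [eventually_gt_atTop 1] with x hx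
  have hL := Real.log_pos hx
  have hx0 : 0 < x := by linarith
  simp only [Pi.div_apply]
  rw [div_div_div_cancel_right₀ hx0.ne', mul_div_mul_right _ _ hL.ne']

lemma in_jac_mod (N n : ℕ) (hn : Odd n) :
    jacobiSym (-(N : ℤ)) (n % (8 * N)) = jacobiSym (-(N : ℤ)) n := by
  have hodd : Odd (n % (8 * N)) := by
    rw [Nat.odd_iff] at hn ⊢
    rw [Nat.mod_mod_of_dvd _ (by omega)]; exact hn
  rw [jacobiSym.mod_right _ hodd, jacobiSym.mod_right _ hn]
  simp only [Int.natAbs_neg, Int.natAbs_natCast]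
  rw [Nat.mod_mod_of_dvd _ (mul_dvd_mul_right (by norm_num) N)]

lemma in_exists_b0 (N : ℕ) (hNpos : 0 < N) (hNsf : Squarefree N)
    (hodd : ∃ p : ℕ, p.Prime ∧ Odd p ∧ p ∣ N) :
    ∃ b : ℕ, b.Coprime (8 * N) ∧ b % 8 = 1 ∧ jacobiSym (-(N : ℤ)) b = -1 := by
  obtain ⟨p, hp, hpo, m, rfl⟩ := hodd
  haveI : Fact p.Prime := ⟨hp⟩
  have hpm : Nat.Coprime p m := (Nat.squarefree_mul_iff.mp hNsf).1
  have hm0 : 0 < m := Nat.pos_of_ne_zero (by rintro rfl; simp at hNpos)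
  have hp2 : p ≠ 2 := by rintro rfl; revert hpo; decide
  have hp8 : Nat.Coprime p (8 * m) := by
    apply Nat.Coprime.mul_right _ hpm
    have : Nat.Coprime p 2 := (Nat.coprime_two_right).mpr hpo
    exact this.pow_right 3
  obtain ⟨r, hr⟩ := quadraticChar_exists_neg_one (F := ZMod p) (by rwa [ZMod.ringChar_zmod_n])
  obtain ⟨b, hb1, hb2⟩ := Nat.chineseRemainder hp8 r.val 1
  have hbp : (b : ZMod p) = r := by
    have := (ZMod.natCast_eq_natCast_iff _ _ _).mpr hb1
    rw [this]; simp
  have hb8 : b % 8 = 1 := by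
    have : b ≡ 1 [MOD 8] := hb2.of_mul_right m
    simpa [Nat.ModEq] using this
  have hbodd : Odd b := by rw [Nat.odd_iff]; omega
  have hleg : jacobiSym (b : ℤ) p = -1 := by
    rw [← jacobiSym.legendreSym.to_jacobiSym, legendreSym]
    push_cast
    rw [hbp, hr]
  have hJp : jacobiSym (p : ℤ) b = -1 := by
    rw [jacobiSym.quadratic_reciprocity_one_mod_four' hpo (by omega), hleg]
  have hJm : jacobiSym (-(m : ℤ)) b = 1 := by
    rw [jacobiSym.mod_right _ hbodd]
    simp only [Int.natAbs_neg, Int.natAbs_natCast]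
    have : b ≡ 1 [MOD (4 * m)] := hb2.of_dvd (mul_dvd_mul_right (by norm_num) m)
    have h1 : b % (4 * m) = 1 := by
      rw [this, Nat.mod_eq_of_lt (by omega)]
    rw [h1, jacobiSym.one_right]
  refine ⟨b, ?_, hb8, ?_⟩
  · have h1 : b.Coprime (8 * m) := by
      rw [Nat.Coprime, hb2.gcd_eq]; simp
    have h2 : b.Coprime p := by
      rw [Nat.coprime_comm, hp.coprime_iff_not_dvd, ← ZMod.natCast_eq_zero_iff, hbp]
      rintro rfl
      simp at hr
    have := h1.mul_right h2
    rwa [show 8 * m * p = 8 * (p * m) by ring] at this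
  · have : (-((p * m : ℕ) : ℤ)) = p * (-(m : ℤ)) := by push_cast; ring
    rw [this, jacobiSym.mul_left, hJp, hJm]; norm_num

open Classical in
noncomputable def inT (N : ℕ) [NeZero (8 * N)] : Finset (ZMod (8 * N)) :=
  Finset.univ.filter (fun a => IsUnit a ∧ jacobiSym (-(N : ℤ)) a.val = -1 ∧
    (a.val % 8 = 3 ∨ a.val % 8 = 5))

open Classical in
lemma inT_card (N : ℕ) [NeZero (8 * N)] (hNpos : 0 < N) (hNsf : Squarefree N)
    (hodd : ∃ p : ℕ, p.Prime ∧ Odd p ∧ p ∣ N) :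
    4 * (inT N).card = (8 * N).totient := by
  obtain ⟨b, hbc, hb8, hbJ⟩ := in_exists_b0 N hNpos hNsf hodd
  obtain ⟨d, hdN, hdp, hd8⟩ := Nat.forall_exists_prime_gt_and_modEq N (q := 8) (a := 3)
    (by norm_num) (by norm_num)
  have hd8' : d % 8 = 3 := by simpa [Nat.ModEq] using hd8
  have hdc : d.Coprime (8 * N) := by
    apply Nat.Coprime.mul_right
    · have : Nat.Coprime d 2 := (Nat.coprime_two_right).mpr (by rw [Nat.odd_iff]; omega)
      exact this.pow_right 3
    · rw [hdp.coprime_iff_not_dvd]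
      intro h
      exact absurd (Nat.le_of_dvd hNpos h) (by omega)
  let w : (ZMod (8 * N))ˣ → ℕ := fun u => (u : ZMod (8 * N)).val
  let ub : (ZMod (8 * N))ˣ := ZMod.unitOfCoprime b hbc
  let ud : (ZMod (8 * N))ˣ := ZMod.unitOfCoprime d hdc
  have hwc : ∀ u : (ZMod (8 * N))ˣ, (w u).Coprime (8 * N) := fun u => ZMod.val_coe_unit_coprime u
  have hwo : ∀ u : (ZMod (8 * N))ˣ, Odd (w u) := fun u => by
    have h := hwc u
    have h2 : (w u).Coprime 2 := h.coprime_dvd_right ⟨4 * N, by ring⟩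
    exact (Nat.coprime_two_right).mp h2
  have hwm : ∀ (u : (ZMod (8 * N))ˣ) (e : ℕ) (he : e.Coprime (8 * N)),
      w (u * ZMod.unitOfCoprime e he) = (w u * e) % (8 * N) := by
    intro u e he
    simp only [w, Units.val_mul, ZMod.coe_unitOfCoprime]
    rw [ZMod.val_mul, ZMod.val_natCast, Nat.mul_mod_mod]
  have hw8 : ∀ (u : (ZMod (8 * N))ˣ) (e : ℕ) (he : e.Coprime (8 * N)),
      w (u * ZMod.unitOfCoprime e he) % 8 = ((w u % 8) * (e % 8)) % 8 := by
    intro u e he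
    rw [hwm, Nat.mod_mod_of_dvd _ (Dvd.intro _ rfl), Nat.mul_mod]
  have hbo : Odd b := by rw [Nat.odd_iff]; omega
  have hJb : ∀ u : (ZMod (8 * N))ˣ, jacobiSym (-(N : ℤ)) (w (u * ub)) = - jacobiSym (-(N : ℤ)) (w u) := by
    intro u
    rw [hwm, in_jac_mod _ _ ((hwo u).mul hbo)]
    have h1 : w u ≠ 0 := by intro h; have := hwo u; rw [h] at this; revert this; decide
    have h2 : b ≠ 0 := by omega
    haveI : NeZero (w u) := ⟨h1⟩
    haveI : NeZero b := ⟨h2⟩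
    rw [jacobiSym.mul_right, hbJ]; ring
  have hJpm : ∀ u : (ZMod (8 * N))ˣ, jacobiSym (-(N : ℤ)) (w u) = 1 ∨ jacobiSym (-(N : ℤ)) (w u) = -1 := by
    intro u
    apply jacobiSym.eq_one_or_neg_one
    rw [Int.neg_gcd, Int.gcd_natCast_natCast]
    exact ((hwc u).coprime_dvd_right (Dvd.intro_left _ rfl)).symm
  have hmod : ∀ u : (ZMod (8 * N))ˣ, w u % 8 = 1 ∨ w u % 8 = 3 ∨ w u % 8 = 5 ∨ w u % 8 = 7 := by
    intro u
    have := hwo u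
    rw [Nat.odd_iff] at this
    omega
  let S35 : Finset (ZMod (8 * N))ˣ := Finset.univ.filter (fun u => w u % 8 = 3 ∨ w u % 8 = 5)
  let S17 : Finset (ZMod (8 * N))ˣ := Finset.univ.filter (fun u => ¬ (w u % 8 = 3 ∨ w u % 8 = 5))
  have c1 : S35.card + S17.card = (8 * N).totient := by
    rw [← ZMod.card_units_eq_totient, ← Finset.card_univ]
    exact Finset.card_filter_add_card_filter_not _
  have c2 : S35.card = S17.card := by
    apply Finset.card_equiv (Equiv.mulRight ud)
    intro u
    simp only [S35, S17, Finset.mem_filter, Finset.mem_univ, true_and, Equiv.coe_mulRight]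
    rw [hw8 u d hdc, hd8']
    rcases hmod u with h | h | h | h <;> rw [h] <;> decide
  let Sm : Finset (ZMod (8 * N))ˣ := S35.filter (fun u => jacobiSym (-(N : ℤ)) (w u) = -1)
  let Sp : Finset (ZMod (8 * N))ˣ := S35.filter (fun u => ¬ jacobiSym (-(N : ℤ)) (w u) = -1)
  have c3 : Sm.card + Sp.card = S35.card := Finset.card_filter_add_card_filter_not _
  have c4 : Sm.card = Sp.card := by
    apply Finset.card_equiv (Equiv.mulRight ub)
    intro u
    simp only [Sm, Sp, S35, Finset.mem_filter, Finset.mem_univ, true_and, Equiv.coe_mulRight]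
    rw [hJb u, hw8 u b hbc, hb8]
    rcases hJpm u with h' | h' <;> rcases hmod u with h | h | h | h <;> rw [h, h'] <;> decide
  have c5 : (inT N).card = Sm.card := by
    symm
    apply Finset.card_bij (fun (u : (ZMod (8 * N))ˣ) _ => (u : ZMod (8 * N)))
    · intro u hu
      simp only [Sm, S35, Finset.mem_filter, Finset.mem_univ, true_and] at hu
      simp only [inT, Finset.mem_filter, Finset.mem_univ, true_and]
      exact ⟨u.isUnit, hu.2, hu.1⟩
    · intro u _ v _ h
      exact Units.ext h
    · intro a ha
      simp only [inT, Finset.mem_filter, Finset.mem_univ, true_and] at ha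
      obtain ⟨⟨u, rfl⟩, h2, h3⟩ := ha
      refine ⟨u, ?_, rfl⟩
      simp only [Sm, S35, Finset.mem_filter, Finset.mem_univ, true_and]
      exact ⟨h3, h2⟩
  omega

lemma in_card_eq (P : ℕ → Prop) (X : ℝ) (hX : 0 ≤ X) :
    Nat.card {p : ℕ | p.Prime ∧ P p ∧ (p : ℝ) ≤ X} = wiPi P X := by
  classical
  unfold wiPi
  have : {p : ℕ | p.Prime ∧ P p ∧ (p : ℝ) ≤ X} =
      ((Finset.Icc 1 ⌊X⌋₊).filter (fun n => n.Prime ∧ P n) : Finset ℕ) := by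
    ext p
    simp only [Set.mem_ofPred_eq, Finset.coe_filter, Finset.mem_Icc, Nat.le_floor_iff hX]
    constructor
    · rintro ⟨h1, h2, h3⟩; exact ⟨⟨h1.one_le, h3⟩, h1, h2⟩
    · rintro ⟨⟨_, h3⟩, h1, h2⟩; exact ⟨h1, h2, h3⟩
  rw [this, Nat.card_coe_set_eq, Set.ncard_coe_finset]


/-- Let `N` be a positive squarefree integer divisible by an odd prime. The set of primes
`ℓ ∤ 2N` which are inert in `ℚ(√-N)` (i.e. the Legendre symbol `(-N | ℓ)` is `-1`) and
satisfy `ℓ ≡ 3, 5 (mod 8)` has natural density `1/4`. -/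
theorem density_inert_three_five_mod_eight (N : ℕ) (hNpos : 0 < N) (hNsf : Squarefree N)
    (hodd : ∃ p : ℕ, p.Prime ∧ Odd p ∧ p ∣ N) :
    HasPrimeDensity
      {ℓ : ℕ | ∃ hℓ : Fact ℓ.Prime, ¬(ℓ ∣ 2 * N) ∧
        legendreSym ℓ (-(N : ℤ)) = -1 ∧ (ℓ % 8 = 3 ∨ ℓ % 8 = 5)}
      (1 / 4) := by
  haveI : NeZero (8 * N) := ⟨by omega⟩
  have hcard := inT_card N hNpos hNsf hodd
  have hlim := wi_density (inT N) (fun a ha => by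
    classical
    simp only [inT, Finset.mem_filter] at ha
    exact ha.2.1)
  have hq : ((inT N).card : ℝ) / (8 * N).totient = 1 / 4 := by
    rw [← hcard]
    have : 0 < (8 * N).totient := Nat.totient_pos.mpr (by omega)
    have h0 : ((inT N).card : ℝ) ≠ 0 := by
      have : (inT N).card ≠ 0 := by omega
      exact_mod_cast this
    push_cast
    field_simp
  rw [hq] at hlim
  unfold HasPrimeDensity
  refine hlim.congr' ?_
  filter_upwards [eventually_ge_atTop 0] with X hX
  have e1 : primePi X = wiPi (fun _ => True) X := by
    rw [← in_card_eq _ X hX]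
    unfold primePi
    simp
  have e2 : primeCount {ℓ : ℕ | ∃ hℓ : Fact ℓ.Prime, ¬(ℓ ∣ 2 * N) ∧
        legendreSym ℓ (-(N : ℤ)) = -1 ∧ (ℓ % 8 = 3 ∨ ℓ % 8 = 5)} X =
      wiPi (fun n => (n : ZMod (8 * N)) ∈ inT N) X := by
    rw [← in_card_eq _ X hX]
    unfold primeCount
    congr 2
    ext p
    simp only [Set.mem_setOf_eq]
    refine and_congr_right fun hp => and_congr_left fun _ => ?_
    simp only [inT, Finset.mem_filter, Finset.mem_univ, true_and, ZMod.val_natCast,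
      ZMod.isUnit_iff_coprime]
    rw [Nat.mod_mod_of_dvd p (Dvd.intro N rfl : 8 ∣ 8 * N)]
    have hcop : ¬ (p ∣ 2 * N) ↔ p.Coprime (8 * N) := by
      rw [hp.coprime_iff_not_dvd, not_iff_not]
      constructor
      · rintro ⟨k, hk⟩; exact ⟨4 * k, by linarith⟩
      · intro h
        rcases hp.dvd_mul.mp h with h | h
        · exact Dvd.dvd.mul_right (hp.dvd_of_dvd_pow (show p ∣ 2 ^ 3 from h)) N
        · exact Dvd.dvd.mul_left h 2
    constructor
    · rintro ⟨hF, h1, h2, h3⟩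
      have hpo : Odd p := by rw [Nat.odd_iff]; omega
      refine ⟨hcop.mp h1, ?_, h3⟩
      rw [in_jac_mod _ _ hpo, ← jacobiSym.legendreSym.to_jacobiSym, h2]
    · rintro ⟨h1, h2, h3⟩
      have hpo : Odd p := by rw [Nat.odd_iff]; omega
      haveI hF : Fact p.Prime := ⟨hp⟩
      refine ⟨hF, hcop.mpr h1, ?_, h3⟩
      rw [in_jac_mod _ _ hpo] at h2
      rw [jacobiSym.legendreSym.to_jacobiSym, h2]
  rw [e1, e2]
end
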